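/- Let (Ω, F, (F_t), P) be a filtered probability space, Q > 0, x ∈ ℝ, and let ψ be a Lévy exponent whose Gaussian coefficient satisfies σ > 0. Let X = (X_t)_{t≥0} be a jointly measurable real-valued adapted process with X_0 = x a.s. satisfying, for all t, s ≥ 0 and θ ∈ ℝ, the Ornstein–Uhlenbeck-type Markov property E[exp(iθ X_{t+s}) | F_t] = exp(i X_t e^{−sQ} θ − ∫₀^s ψ(e^{−uQ}θ) du) a.s. Then for Lebesgue-almost every y ∈ ℝ there exists a process (L(y,t))_{t≥0} such that for every T > 0, sup_{t ≤ T} ‖ (1/(2ε)) ∫₀^t 1_{{|X_s − y| < ε}} ds − L(y,t) ‖_{L²(P)} → 0 as ε → 0+, and the process t ↦ L(y,t) admits an almost surely continuous modification. -/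

import Mathlib

open MeasureTheory Complex Filter Topology

/-- The Lévy exponent with drift `b`, Gaussian coefficient `σ` and Lévy measure `ρ`:
`ψ(θ) = i b θ + σ²θ²/2 − ∫ (e^{iθu} − 1 − iθu/(1+u²)) ρ(du)`. -/
noncomputable def levyExponent (b σ : ℝ) (ρ : Measure ℝ) (θ : ℝ) : ℂ :=
  Complex.I * b * θ + σ ^ 2 * θ ^ 2 / 2
    - ∫ u : ℝ, (Complex.exp (Complex.I * θ * u) - 1 - Complex.I * θ * u / (1 + u ^ 2)) ∂ρ

/-- `ρ` is a Lévy measure: no mass at `0` and `∫ min(1,u²) ρ(du) < ∞`. -/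
def IsLevyMeasure (ρ : Measure ℝ) : Prop :=
  ρ {0} = 0 ∧ ∫⁻ u : ℝ, ENNReal.ofReal (min 1 (u ^ 2)) ∂ρ < ⊤

lemma norm_exp_mul_I_sub_one_sub_le (a : ℝ) :
    ‖Complex.exp (Complex.I * a) - 1 - Complex.I * a‖ ≤ 3 * a ^ 2 := by
  rcases le_or_gt |a| 1 with h | h
  · have hn : ‖Complex.I * (a : ℂ)‖ = |a| := by simp
    have := Complex.norm_exp_sub_one_sub_id_le (x := Complex.I * a) (by rw [hn]; exact h)
    rw [hn, sq_abs] at this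
    nlinarith [sq_nonneg a]
  · have h1 : ‖Complex.exp (Complex.I * a) - 1‖ ≤ |a| := by
      simpa using Real.norm_exp_I_mul_ofReal_sub_one_le (x := a)
    have h2 : ‖Complex.I * (a : ℂ)‖ = |a| := by simp
    have h3 := norm_sub_le (Complex.exp (Complex.I * a) - 1) (Complex.I * a)
    nlinarith [sq_abs a]

lemma norm_levyIntegrand_le {R θ : ℝ} (hθ : |θ| ≤ R) (u : ℝ) :
    ‖Complex.exp (Complex.I * θ * u) - 1 - Complex.I * θ * u / (1 + u ^ 2)‖
      ≤ (3 * R ^ 2 + R + 2) * min 1 (u ^ 2) := by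
  have hR : 0 ≤ R := (abs_nonneg θ).trans hθ
  have hu : (0 : ℝ) < 1 + u ^ 2 := by positivity
  have hθ2 : θ ^ 2 ≤ R ^ 2 := by rw [← sq_abs]; gcongr
  rcases le_total 1 (u ^ 2) with h | h
  · rw [min_eq_left h, mul_one]
    have h1 : ‖Complex.exp (Complex.I * θ * u)‖ = 1 := by
      rw [show Complex.I * θ * u = ((θ * u : ℝ) : ℂ) * Complex.I by push_cast; ring]
      exact Complex.norm_exp_ofReal_mul_I _
    have h2 : ‖Complex.I * θ * u / (1 + (u : ℂ) ^ 2)‖ ≤ R := by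
      rw [show Complex.I * θ * u / (1 + (u : ℂ) ^ 2)
        = Complex.I * ((θ * (u / (1 + u ^ 2)) : ℝ) : ℂ) by push_cast; ring]
      rw [norm_mul, Complex.norm_I, one_mul, Complex.norm_real, Real.norm_eq_abs, abs_mul]
      have : |u / (1 + u ^ 2)| ≤ 1 := by
        rw [abs_div, abs_of_pos hu, div_le_one hu]
        nlinarith [sq_abs u, abs_nonneg u, sq_nonneg (|u| - 1)]
      calc |θ| * |u / (1 + u ^ 2)| ≤ R * 1 := by gcongr
        _ = R := mul_one R
    calc _ ≤ ‖Complex.exp (Complex.I * θ * u)‖ + ‖(1 : ℂ)‖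
          + ‖Complex.I * θ * u / (1 + (u : ℂ) ^ 2)‖ :=
            (norm_sub_le _ _).trans (add_le_add_left (norm_sub_le _ _) _)
      _ ≤ 1 + 1 + R := by rw [h1, norm_one]; gcongr
      _ ≤ _ := by nlinarith [sq_nonneg R]
  · rw [min_eq_right h]
    have h1 := norm_exp_mul_I_sub_one_sub_le (θ * u)
    have e : Complex.exp (Complex.I * θ * u) - 1 - Complex.I * θ * u / (1 + (u : ℂ) ^ 2)
        = (Complex.exp (Complex.I * ((θ * u : ℝ) : ℂ)) - 1 - Complex.I * ((θ * u : ℝ) : ℂ))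
          + Complex.I * ((θ * (u ^ 3 / (1 + u ^ 2)) : ℝ) : ℂ) := by
      have : (1 + (u : ℂ) ^ 2) ≠ 0 := by exact_mod_cast hu.ne'
      push_cast
      rw [mul_assoc]
      field_simp
      ring
    have h2 : ‖Complex.I * ((θ * (u ^ 3 / (1 + u ^ 2)) : ℝ) : ℂ)‖ ≤ R * u ^ 2 := by
      rw [norm_mul, Complex.norm_I, one_mul, Complex.norm_real, Real.norm_eq_abs, abs_mul]
      have : |u ^ 3 / (1 + u ^ 2)| ≤ u ^ 2 := by
        rw [abs_div, abs_of_pos hu, div_le_iff₀ hu, abs_pow]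
        have : |u| ≤ 1 := by nlinarith [sq_abs u, abs_nonneg u]
        nlinarith [sq_abs u, abs_nonneg u, sq_nonneg (|u|), pow_nonneg (abs_nonneg u) 3,
          mul_le_mul_of_nonneg_right this (sq_nonneg (|u|))]
      gcongr
    rw [e]
    refine (norm_add_le _ _).trans ((add_le_add h1 h2).trans ?_)
    nlinarith [sq_nonneg u, mul_le_mul_of_nonneg_right hθ2 (sq_nonneg u)]

lemma IsLevyMeasure.integrable_min {ρ : Measure ℝ} (hρ : IsLevyMeasure ρ) :
    Integrable (fun u : ℝ => min 1 (u ^ 2)) ρ := by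
  refine ⟨by fun_prop, ?_⟩
  rw [hasFiniteIntegral_iff_ofReal (Eventually.of_forall fun u => by positivity)]
  exact hρ.2

lemma continuous_levyExponent (b σ : ℝ) {ρ : Measure ℝ} (hρ : IsLevyMeasure ρ) :
    Continuous (levyExponent b σ ρ) := by
  have h : Continuous fun θ : ℝ => ∫ u : ℝ,
      (Complex.exp (Complex.I * θ * u) - 1 - Complex.I * θ * u / (1 + u ^ 2)) ∂ρ := by
    rw [continuous_iff_continuousAt]
    intro θ₀
    refine continuousAt_of_dominated
      (bound := fun u => (3 * (|θ₀| + 1) ^ 2 + (|θ₀| + 1) + 2) * min 1 (u ^ 2)) ?_ ?_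
      (hρ.integrable_min.const_mul _) ?_
    · exact Eventually.of_forall fun θ => (by fun_prop : Measurable _).aestronglyMeasurable
    · filter_upwards [Metric.ball_mem_nhds θ₀ one_pos] with θ hθ
      refine Eventually.of_forall fun u => norm_levyIntegrand_le ?_ u
      rw [Metric.mem_ball, Real.dist_eq] at hθ
      linarith [abs_sub_abs_le_abs_sub θ θ₀]
    · exact Eventually.of_forall fun u => by fun_prop
  unfold levyExponent
  fun_prop

lemma le_re_levyExponent (b σ : ℝ) (ρ : Measure ℝ) (θ : ℝ) :
    σ ^ 2 * θ ^ 2 / 2 ≤ (levyExponent b σ ρ θ).re := by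
  have h : (∫ u : ℝ, (Complex.exp (Complex.I * θ * u) - 1
      - Complex.I * θ * u / (1 + u ^ 2)) ∂ρ).re ≤ 0 := by
    by_cases hi : Integrable (fun u : ℝ => Complex.exp (Complex.I * θ * u) - 1
      - Complex.I * θ * u / (1 + u ^ 2)) ρ
    · rw [← RCLike.re_eq_complex_re, ← integral_re hi]
      refine integral_nonpos fun u => ?_
      have : Complex.exp (Complex.I * θ * u) - 1 - Complex.I * θ * u / (1 + (u : ℂ) ^ 2)
          = Complex.exp (((θ * u : ℝ) : ℂ) * Complex.I) - 1
            - ((θ * u / (1 + u ^ 2) : ℝ) : ℂ) * Complex.I := by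
        push_cast
        ring_nf
      simp only [this, RCLike.re_eq_complex_re, Complex.sub_re, Complex.exp_ofReal_mul_I_re,
        Complex.one_re, Complex.re_ofReal_mul, Complex.I_re, mul_zero, sub_zero, Pi.zero_apply]
      linarith [Real.cos_le_one (θ * u)]
    · rw [integral_undef hi, Complex.zero_re]
  have e : (Complex.I * b * θ + σ ^ 2 * θ ^ 2 / 2 : ℂ)
      = ((σ ^ 2 * θ ^ 2 / 2 : ℝ) : ℂ) + ((b * θ : ℝ) : ℂ) * Complex.I := by push_cast; ring
  unfold levyExponent
  rw [e, Complex.sub_re, Complex.add_re, Complex.ofReal_re, Complex.re_ofReal_mul, Complex.I_re]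
  linarith

lemma le_re_integral_levyExponent (b σ : ℝ) {ρ : Measure ℝ} (hρ : IsLevyMeasure ρ)
    {Q s T : ℝ} (hQ : 0 < Q) (hs : 0 ≤ s) (hsT : s ≤ T) (θ : ℝ) :
    σ ^ 2 / 2 * Real.exp (-(2 * T * Q)) * s * θ ^ 2
      ≤ (∫ u in Set.Icc 0 s, levyExponent b σ ρ (Real.exp (-u * Q) * θ)).re := by
  have hc : Continuous fun u : ℝ => levyExponent b σ ρ (Real.exp (-u * Q) * θ) :=
    (continuous_levyExponent b σ hρ).comp (by fun_prop)
  have hi : IntegrableOn (fun u : ℝ => levyExponent b σ ρ (Real.exp (-u * Q) * θ))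
      (Set.Icc 0 s) := hc.continuousOn.integrableOn_Icc
  rw [← RCLike.re_eq_complex_re, ← integral_re hi]
  have h0 : σ ^ 2 / 2 * Real.exp (-(2 * T * Q)) * s * θ ^ 2
      = ∫ _u in Set.Icc 0 s, σ ^ 2 / 2 * Real.exp (-(2 * T * Q)) * θ ^ 2 := by
    simp [hs]
    ring
  rw [h0]
  refine setIntegral_mono_on (integrableOn_const (by simp)) hi.re measurableSet_Icc fun u hu => ?_
  refine le_trans ?_ (le_re_levyExponent b σ ρ _)
  have h1 : Real.exp (-(2 * T * Q)) ≤ Real.exp (-u * Q) ^ 2 := by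
    rw [← Real.exp_nat_mul]
    refine Real.exp_le_exp.2 ?_
    push_cast
    nlinarith [mul_le_mul_of_nonneg_right (hu.2.trans hsT) hQ.le]
  calc σ ^ 2 / 2 * Real.exp (-(2 * T * Q)) * θ ^ 2
      ≤ σ ^ 2 / 2 * Real.exp (-u * Q) ^ 2 * θ ^ 2 := by gcongr
    _ = _ := by ring

open FourierTransform SchwartzMap in
lemma SchwartzMap.eq_integral_exp_mul_fourier (f : 𝓢(ℝ, ℂ)) (u : ℝ) :
    f u = ∫ α : ℝ, Complex.exp ((2 * Real.pi * (α * u) : ℝ) * Complex.I)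
      * 𝓕 (f : ℝ → ℂ) α := by
  have h : 𝓕⁻ (𝓕 (f : ℝ → ℂ)) = f :=
    f.continuous.fourierInv_fourier_eq f.integrable (by
      rw [← SchwartzMap.fourier_coe]; exact (𝓕 f).integrable)
  conv_lhs => rw [← h]
  rw [Real.fourierInv_eq']
  simp [mul_comm]

/-- The joint characteristic function of `(U, V)`, at `2π` times the argument. -/
noncomputable def pairCharFun {Ω : Type*} {m : MeasurableSpace Ω} (P : Measure Ω)
    (U V : Ω → ℝ) (p : ℝ × ℝ) : ℂ :=
  ∫ ω, Complex.exp ((2 * Real.pi * (p.1 * U ω + p.2 * V ω) : ℝ) * Complex.I) ∂P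

section PairCharFun

variable {Ω : Type*} {m : MeasurableSpace Ω} {P : Measure Ω} [IsProbabilityMeasure P]
  {U V : Ω → ℝ}

lemma stronglyMeasurable_pairCharFun (hU : Measurable U) (hV : Measurable V) :
    StronglyMeasurable (pairCharFun P U V) := by
  have : Measurable (Function.uncurry fun (p : ℝ × ℝ) (ω : Ω) =>
      Complex.exp ((2 * Real.pi * (p.1 * U ω + p.2 * V ω) : ℝ) * Complex.I)) := by
    unfold Function.uncurry
    fun_prop
  exact this.stronglyMeasurable.integral_prod_right

open FourierTransform SchwartzMap in
lemma integral_schwartz_mul_schwartz (hU : Measurable U) (hV : Measurable V)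
    (f h : 𝓢(ℝ, ℂ)) :
    ∫ ω, f (U ω) * h (V ω) ∂P
      = ∫ p : ℝ × ℝ, 𝓕 (f : ℝ → ℂ) p.1 * 𝓕 (h : ℝ → ℂ) p.2 * pairCharFun P U V p := by
  have hfi : Integrable (𝓕 (f : ℝ → ℂ)) := by
    rw [← SchwartzMap.fourier_coe]; exact (𝓕 f).integrable
  have hhi : Integrable (𝓕 (h : ℝ → ℂ)) := by
    rw [← SchwartzMap.fourier_coe]; exact (𝓕 h).integrable
  have hfh : Integrable (fun p : ℝ × ℝ => 𝓕 (f : ℝ → ℂ) p.1 * 𝓕 (h : ℝ → ℂ) p.2) :=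
    hfi.mul_prod hhi
  have hprodInt : Integrable (Function.uncurry fun (ω : Ω) (p : ℝ × ℝ) =>
      𝓕 (f : ℝ → ℂ) p.1 * 𝓕 (h : ℝ → ℂ) p.2
        * Complex.exp ((2 * Real.pi * (p.1 * U ω + p.2 * V ω) : ℝ) * Complex.I))
      (P.prod volume) := by
    have h1 : Integrable (fun z : Ω × (ℝ × ℝ) =>
        𝓕 (f : ℝ → ℂ) z.2.1 * 𝓕 (h : ℝ → ℂ) z.2.2) (P.prod volume) := hfh.comp_snd P
    refine h1.mul_bdd (c := 1) ?_ (Eventually.of_forall fun z => ?_)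
    · exact (by fun_prop : Measurable fun z : Ω × (ℝ × ℝ) =>
        Complex.exp ((2 * Real.pi * (z.2.1 * U z.1 + z.2.2 * V z.1) : ℝ) * Complex.I)
        ).aestronglyMeasurable
    · exact (Complex.norm_exp_ofReal_mul_I _).le
  calc ∫ ω, f (U ω) * h (V ω) ∂P
      = ∫ ω, (∫ p : ℝ × ℝ, 𝓕 (f : ℝ → ℂ) p.1 * 𝓕 (h : ℝ → ℂ) p.2
        * Complex.exp ((2 * Real.pi * (p.1 * U ω + p.2 * V ω) : ℝ) * Complex.I)) ∂P := by
        refine integral_congr_ae (Eventually.of_forall fun ω => ?_)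
        simp only
        rw [f.eq_integral_exp_mul_fourier, h.eq_integral_exp_mul_fourier, ← integral_prod_mul]
        refine integral_congr_ae (Eventually.of_forall fun p => ?_)
        simp only
        rw [mul_add, Complex.ofReal_add, add_mul, Complex.exp_add]
        ring
    _ = _ := by
        rw [integral_integral_swap hprodInt]
        refine integral_congr_ae (Eventually.of_forall fun p => ?_)
        simp only
        rw [integral_const_mul, pairCharFun]

/-- `f` is a pointwise limit of Schwartz functions which are dominated by a bounded integrable
function. -/
def IsSchwartzLimit (f : ℝ → ℂ) : Prop :=
  ∃ (F : ℕ → SchwartzMap ℝ ℂ) (g : ℝ → ℝ) (C : ℝ), Integrable g ∧ (∀ z, g z ≤ C) ∧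
    (∀ n z, ‖F n z‖ ≤ g z) ∧ ∀ z, Tendsto (fun n => F n z) atTop (𝓝 (f z))

lemma IsSchwartzLimit.sub {f h : ℝ → ℂ} (hf : IsSchwartzLimit f) (hh : IsSchwartzLimit h) :
    IsSchwartzLimit (fun z => f z - h z) := by
  obtain ⟨F, g, C, hg, hgC, hFg, hF⟩ := hf
  obtain ⟨F', g', C', hg', hgC', hFg', hF'⟩ := hh
  refine ⟨fun n => F n - F' n, fun z => g z + g' z, C + C', hg.add hg',
    fun z => add_le_add (hgC z) (hgC' z), fun n z => ?_, fun z => ?_⟩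
  · exact (norm_sub_le _ _).trans (add_le_add (hFg n z) (hFg' n z))
  · exact (hF z).sub (hF' z)

open FourierTransform SchwartzMap in
lemma IsSchwartzLimit.integral_mul {f : ℝ → ℂ} (hf : IsSchwartzLimit f)
    (hU : Measurable U) (hV : Measurable V) (hχ : Integrable (pairCharFun P U V)) :
    ∫ ω, f (U ω) * f (V ω) ∂P
      = ∫ p : ℝ × ℝ, 𝓕 f p.1 * 𝓕 f p.2 * pairCharFun P U V p := by
  obtain ⟨F, g, C, hg, hgC, hFg, hF⟩ := hf
  have hC : 0 ≤ C := ((norm_nonneg _).trans (hFg 0 0)).trans (hgC 0)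
  have hFC : ∀ n z, ‖F n z‖ ≤ C := fun n z => (hFg n z).trans (hgC z)
  have hft : ∀ w, Tendsto (fun n => 𝓕 (F n : ℝ → ℂ) w) atTop (𝓝 (𝓕 f w)) := by
    intro w
    simp only [Real.fourier_real_eq_integral_exp_smul]
    refine tendsto_integral_of_dominated_convergence g (fun n => ?_) hg (fun n => ?_) ?_
    · exact ((by fun_prop : Continuous fun v : ℝ =>
        Complex.exp ((-2 * Real.pi * v * w : ℝ) * Complex.I)).smul
          (F n).continuous).aestronglyMeasurable
    · refine Eventually.of_forall fun v => ?_
      rw [norm_smul, Complex.norm_exp_ofReal_mul_I, one_mul]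
      exact hFg n v
    · exact Eventually.of_forall fun v => (hF v).const_smul _
  have hfb : ∀ n w, ‖𝓕 (F n : ℝ → ℂ) w‖ ≤ ∫ v, g v := by
    intro n w
    rw [Real.fourier_real_eq_integral_exp_smul]
    refine norm_integral_le_of_norm_le hg (Eventually.of_forall fun v => ?_)
    rw [norm_smul, Complex.norm_exp_ofReal_mul_I, one_mul]
    exact hFg n v
  have hfc : ∀ n, Continuous (𝓕 (F n : ℝ → ℂ)) := fun n => by
    rw [← SchwartzMap.fourier_coe]; exact (𝓕 (F n)).continuous
  have hL : Tendsto (fun n => ∫ ω, F n (U ω) * F n (V ω) ∂P) atTop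
      (𝓝 (∫ ω, f (U ω) * f (V ω) ∂P)) := by
    refine tendsto_integral_of_dominated_convergence (fun _ => C * C) (fun n => ?_)
      (integrable_const _) (fun n => ?_) ?_
    · exact (((F n).continuous.measurable.comp hU).mul
        ((F n).continuous.measurable.comp hV)).aestronglyMeasurable
    · refine Eventually.of_forall fun ω => ?_
      rw [norm_mul]
      exact mul_le_mul (hFC _ _) (hFC _ _) (norm_nonneg _) hC
    · exact Eventually.of_forall fun ω => (hF _).mul (hF _)
  have hR : Tendsto (fun n => ∫ p : ℝ × ℝ,
      𝓕 (F n : ℝ → ℂ) p.1 * 𝓕 (F n : ℝ → ℂ) p.2 * pairCharFun P U V p) atTop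
      (𝓝 (∫ p : ℝ × ℝ, 𝓕 f p.1 * 𝓕 f p.2 * pairCharFun P U V p)) := by
    refine tendsto_integral_of_dominated_convergence
      (fun p => (∫ v, g v) * (∫ v, g v) * ‖pairCharFun P U V p‖) (fun n => ?_)
      (hχ.norm.const_mul _) (fun n => ?_) ?_
    · have := hfc n
      exact (by fun_prop : Continuous fun p : ℝ × ℝ =>
        𝓕 (F n : ℝ → ℂ) p.1 * 𝓕 (F n : ℝ → ℂ) p.2).aestronglyMeasurable.mul
          hχ.aestronglyMeasurable
    · refine Eventually.of_forall fun p => ?_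
      rw [norm_mul, norm_mul]
      have := (norm_nonneg _).trans (hfb n p.1)
      gcongr
      · exact hfb n p.1
      · exact hfb n p.2
    · exact Eventually.of_forall fun p => ((hft _).mul (hft _)).mul_const _
  simp only [integral_schwartz_mul_schwartz hU hV] at hL
  exact tendsto_nhds_unique hL hR

end PairCharFun

/-- The normalized indicator of the interval of radius `ε` about `y`. -/
noncomputable def windowKernel (y ε z : ℝ) : ℝ :=
  1 / (2 * ε) * if |z - y| < ε then (1 : ℝ) else 0

lemma windowKernel_eq_indicator (y ε : ℝ) :
    windowKernel y ε = (Metric.ball y ε).indicator fun _ => 1 / (2 * ε) := by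
  ext z
  by_cases h : |z - y| < ε <;> simp [windowKernel, Set.indicator, Real.dist_eq, h]

lemma measurable_windowKernel (y ε : ℝ) : Measurable (windowKernel y ε) := by
  rw [windowKernel_eq_indicator]
  exact measurable_const.indicator measurableSet_ball

lemma windowKernel_nonneg (y : ℝ) {ε : ℝ} (hε : 0 < ε) (z : ℝ) : 0 ≤ windowKernel y ε z := by
  unfold windowKernel
  positivity

lemma windowKernel_le (y : ℝ) {ε : ℝ} (hε : 0 < ε) (z : ℝ) :
    windowKernel y ε z ≤ 1 / (2 * ε) := by
  rw [windowKernel_eq_indicator]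
  exact Set.indicator_le_self' (fun _ _ => by positivity) z

lemma integrable_windowKernel (y ε : ℝ) : Integrable (windowKernel y ε) := by
  rw [windowKernel_eq_indicator, integrable_indicator_iff measurableSet_ball]
  exact integrableOn_const measure_ball_lt_top.ne

lemma integral_windowKernel (y : ℝ) {ε : ℝ} (hε : 0 < ε) : ∫ z, windowKernel y ε z = 1 := by
  rw [windowKernel_eq_indicator, integral_indicator_const _ measurableSet_ball,
    Measure.real, Real.volume_ball, ENNReal.toReal_ofReal (by positivity), smul_eq_mul]
  field_simp

lemma isSchwartzLimit_windowKernel (y : ℝ) {ε : ℝ} (hε : 0 < ε) :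
    IsSchwartzLimit (fun z => (windowKernel y ε z : ℂ)) := by
  have hr : ∀ n : ℕ, 0 < ε * (1 - 1 / (n + 2 : ℝ)) ∧ ε * (1 - 1 / (n + 2 : ℝ)) < ε := fun n => by
    have h2 : (0 : ℝ) < n + 2 := by positivity
    have h3 : 1 / (n + 2 : ℝ) < 1 := by rw [div_lt_one h2]; linarith [n.cast_nonneg (α := ℝ)]
    have h4 : 0 < 1 / (n + 2 : ℝ) := by positivity
    exact ⟨mul_pos hε (by linarith), by nlinarith⟩
  let B : ℕ → ContDiffBump y := fun n => ⟨ε * (1 - 1 / (n + 2 : ℝ)), ε, (hr n).1, (hr n).2⟩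
  have hcomp : ∀ n, HasCompactSupport fun z => ((1 / (2 * ε) * B n z : ℝ) : ℂ) := fun n =>
    ((B n).hasCompactSupport.mul_left (f := fun _ => 1 / (2 * ε))).comp_left
      (g := fun x : ℝ => (x : ℂ)) Complex.ofReal_zero
  have hsm : ∀ n, ContDiff ℝ ((⊤ : ℕ∞) : WithTop ℕ∞)
      fun z => ((1 / (2 * ε) * B n z : ℝ) : ℂ) := fun n =>
    Complex.ofRealCLM.contDiff.comp (contDiff_const.mul (B n).contDiff)
  refine ⟨fun n => (hcomp n).toSchwartzMap (hsm n), windowKernel y ε, 1 / (2 * ε),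
    integrable_windowKernel y ε, windowKernel_le y hε, fun n z => ?_, fun z => ?_⟩
  · change ‖((1 / (2 * ε) * B n z : ℝ) : ℂ)‖ ≤ _
    rw [Complex.norm_real, Real.norm_of_nonneg (mul_nonneg (by positivity) (B n).nonneg)]
    unfold windowKernel
    gcongr
    split_ifs with h
    · exact (B n).le_one
    · exact ((B n).zero_of_le_dist (by rw [Real.dist_eq]; exact not_lt.1 h)).le
  · change Tendsto (fun n => ((1 / (2 * ε) * B n z : ℝ) : ℂ)) atTop _
    refine tendsto_const_nhds.congr' ?_
    unfold windowKernel
    beta_reduce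
    split_ifs with h
    · have hlim : Tendsto (fun n : ℕ => ε * (1 - 1 / (n + 2 : ℝ))) atTop (𝓝 (ε * (1 - 0))) := by
        refine (tendsto_const_nhds.sub ?_).const_mul _
        refine Tendsto.div_atTop tendsto_const_nhds ?_
        exact tendsto_atTop_add_const_right _ _ tendsto_natCast_atTop_atTop
      filter_upwards [hlim.eventually_const_lt (by simpa using h : |z - y| < ε * (1 - 0))]
        with n hn
      rw [(B n).one_of_mem_closedBall (by
        rw [Metric.mem_closedBall, Real.dist_eq]; exact hn.le)]
    · refine Eventually.of_forall fun n => ?_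
      beta_reduce
      rw [(B n).zero_of_le_dist (by rw [Real.dist_eq]; exact not_lt.1 h)]

open FourierTransform in
lemma norm_fourier_windowKernel_le (y : ℝ) {ε : ℝ} (hε : 0 < ε) (w : ℝ) :
    ‖𝓕 (fun z => (windowKernel y ε z : ℂ)) w‖ ≤ 1 := by
  rw [Real.fourier_real_eq_integral_exp_smul, ← integral_windowKernel y hε]
  refine norm_integral_le_of_norm_le (integrable_windowKernel y ε)
    (Eventually.of_forall fun v => ?_)
  rw [norm_smul, Complex.norm_exp_ofReal_mul_I, one_mul, Complex.norm_real,
    Real.norm_of_nonneg (windowKernel_nonneg y hε v)]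

open FourierTransform in
lemma norm_fourier_windowKernel_sub_exp_le (y : ℝ) {ε : ℝ} (hε : 0 < ε) (w : ℝ) :
    ‖𝓕 (fun z => (windowKernel y ε z : ℂ)) w
      - Complex.exp ((-2 * Real.pi * y * w : ℝ) * Complex.I)‖ ≤ 2 * Real.pi * |w| * ε := by
  have hK : Integrable (fun v => (windowKernel y ε v : ℂ)) := (integrable_windowKernel y ε).ofReal
  have hi : Integrable (fun v => Complex.exp ((-2 * Real.pi * v * w : ℝ) * Complex.I)
      • (windowKernel y ε v : ℂ)) := by
    refine hK.bdd_mul (c := 1) ?_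
      (Eventually.of_forall fun v => (Complex.norm_exp_ofReal_mul_I _).le)
    exact (by fun_prop : Continuous fun v : ℝ =>
      Complex.exp ((-2 * Real.pi * v * w : ℝ) * Complex.I)).aestronglyMeasurable
  have hc : Complex.exp ((-2 * Real.pi * y * w : ℝ) * Complex.I)
      = ∫ v, Complex.exp ((-2 * Real.pi * y * w : ℝ) * Complex.I) * (windowKernel y ε v : ℂ) := by
    rw [integral_const_mul, integral_complex_ofReal, integral_windowKernel y hε]
    simp
  rw [Real.fourier_real_eq_integral_exp_smul, hc,
    ← integral_sub hi (hK.const_mul _)]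
  have hR : 2 * Real.pi * |w| * ε = ∫ v, 2 * Real.pi * |w| * ε * windowKernel y ε v := by
    rw [integral_const_mul, integral_windowKernel y hε, mul_one]
  rw [hR]
  refine norm_integral_le_of_norm_le ((integrable_windowKernel y ε).const_mul _)
    (Eventually.of_forall fun v => ?_)
  rw [smul_eq_mul, ← sub_mul, norm_mul, Complex.norm_real,
    Real.norm_of_nonneg (windowKernel_nonneg y hε v)]
  by_cases hv : |v - y| < ε
  · gcongr
    · exact windowKernel_nonneg y hε v
    have e : Complex.exp ((-2 * Real.pi * v * w : ℝ) * Complex.I)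
        - Complex.exp ((-2 * Real.pi * y * w : ℝ) * Complex.I)
        = Complex.exp ((-2 * Real.pi * y * w : ℝ) * Complex.I)
          * (Complex.exp (Complex.I * (-2 * Real.pi * (v - y) * w : ℝ)) - 1) := by
      rw [mul_sub, mul_one, ← Complex.exp_add]
      congr 2
      push_cast
      ring
    rw [e, norm_mul, Complex.norm_exp_ofReal_mul_I, one_mul]
    refine Real.norm_exp_I_mul_ofReal_sub_one_le.trans ?_
    rw [Real.norm_eq_abs, abs_mul, abs_mul, abs_mul, abs_neg, abs_two, abs_of_pos Real.pi_pos]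
    nlinarith [mul_le_mul_of_nonneg_left hv.le
      (mul_nonneg (mul_nonneg zero_le_two Real.pi_pos.le) (abs_nonneg w))]
  · simp [windowKernel, hv]

lemma measurePreserving_shear (l : ℝ) :
    MeasurePreserving (fun p : ℝ × ℝ => (p.1 + l * p.2, p.2)) := by
  have h : MeasurePreserving (fun p : ℝ × ℝ => (p.1, p.2 + l * p.1))
      (volume.prod volume) (volume.prod volume) :=
    (MeasurePreserving.id volume).skew_product (g := fun a c => c + l * a)
      (by unfold Function.uncurry; fun_prop)
      (Eventually.of_forall fun a => (measurePreserving_add_right volume (l * a)).map_eq)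
  exact (Measure.measurePreserving_swap.comp h).comp Measure.measurePreserving_swap

lemma integrable_gaussian_shear {a d : ℝ} (ha : 0 < a) (hd : 0 < d) (l : ℝ) :
    Integrable (fun p : ℝ × ℝ => Real.exp (-a * (p.1 + l * p.2) ^ 2)
      * Real.exp (-d * p.2 ^ 2)) := by
  have h : Integrable (fun p : ℝ × ℝ => Real.exp (-a * p.1 ^ 2) * Real.exp (-d * p.2 ^ 2)) :=
    (integrable_exp_neg_mul_sq ha).mul_prod (integrable_exp_neg_mul_sq hd)
  exact (measurePreserving_shear l).integrable_comp_of_integrable h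

lemma integral_gaussian_shear (a d l : ℝ) :
    ∫ p : ℝ × ℝ, Real.exp (-a * (p.1 + l * p.2) ^ 2) * Real.exp (-d * p.2 ^ 2)
      = √(Real.pi / a) * √(Real.pi / d) := by
  have hm : AEStronglyMeasurable
      (fun p : ℝ × ℝ => Real.exp (-a * p.1 ^ 2) * Real.exp (-d * p.2 ^ 2))
      (Measure.map (fun p : ℝ × ℝ => (p.1 + l * p.2, p.2)) volume) := by fun_prop
  rw [← integral_gaussian, ← integral_gaussian, ← integral_prod_mul]
  conv_rhs => rw [← Measure.volume_eq_prod, ← (measurePreserving_shear l).map_eq]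
  rw [integral_map (measurePreserving_shear l).measurable.aemeasurable hm]

/-- The Ornstein–Uhlenbeck type Markov property of `X` with driving Lévy exponent `ψ`. -/
def IsOUType {Ω : Type*} {m : MeasurableSpace Ω} (P : Measure Ω) (𝓕 : Filtration ℝ m) (Q : ℝ)
    (ψ : ℝ → ℂ) (X : ℝ → Ω → ℝ) : Prop :=
  ∀ t s : ℝ, 0 ≤ t → 0 ≤ s → ∀ θ : ℝ,
    P[fun ω => Complex.exp (Complex.I * θ * (X (t + s) ω : ℂ)) | 𝓕 t]
      =ᵐ[P] fun ω => Complex.exp (Complex.I * (X t ω : ℂ) * Real.exp (-s * Q) * θ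
        - ∫ u in Set.Icc 0 s, ψ (Real.exp (-u * Q) * θ))

section OU

variable {Ω : Type*} {m : MeasurableSpace Ω} {P : Measure Ω} [IsProbabilityMeasure P]
  {𝓖 : Filtration ℝ m} {Q b σ : ℝ} {ρ : Measure ℝ} {X : ℝ → Ω → ℝ}

lemma integrable_exp_I_mul {U : Ω → ℝ} (hU : Measurable U) (θ : ℝ) :
    Integrable (fun ω => Complex.exp (Complex.I * θ * (U ω : ℂ))) P := by
  refine Integrable.of_bound (C := 1) (by fun_prop) (Eventually.of_forall fun ω => ?_)
  rw [show Complex.I * θ * (U ω : ℂ) = ((θ * U ω : ℝ) : ℂ) * Complex.I by push_cast; ring]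
  exact (Complex.norm_exp_ofReal_mul_I _).le

lemma norm_exp_OU_le (hρ : IsLevyMeasure ρ) (hQ : 0 < Q) {s T : ℝ} (hs : 0 ≤ s) (hsT : s ≤ T)
    (θ z : ℝ) :
    ‖Complex.exp (Complex.I * (z : ℂ) * Real.exp (-s * Q) * θ
      - ∫ u in Set.Icc 0 s, levyExponent b σ ρ (Real.exp (-u * Q) * θ))‖
      ≤ Real.exp (-(σ ^ 2 / 2 * Real.exp (-(2 * T * Q)) * s * θ ^ 2)) := by
  rw [Complex.norm_exp, Complex.sub_re,
    show Complex.I * (z : ℂ) * Real.exp (-s * Q) * θ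
      = ((z * Real.exp (-s * Q) * θ : ℝ) : ℂ) * Complex.I by push_cast; ring,
    Complex.re_ofReal_mul, Complex.I_re, mul_zero, zero_sub]
  exact Real.exp_le_exp.2 (neg_le_neg (le_re_integral_levyExponent b σ hρ hQ hs hsT θ))

lemma IsOUType.norm_charFun_le (hM : IsOUType P 𝓖 Q (levyExponent b σ ρ) X)
    (hρ : IsLevyMeasure ρ) (hQ : 0 < Q) {s T : ℝ} (hs : 0 ≤ s) (hsT : s ≤ T) (θ : ℝ) :
    ‖∫ ω, Complex.exp (Complex.I * θ * (X s ω : ℂ)) ∂P‖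
      ≤ Real.exp (-(σ ^ 2 / 2 * Real.exp (-(2 * T * Q)) * s * θ ^ 2)) := by
  have h := hM 0 s le_rfl hs θ
  rw [zero_add] at h
  rw [← integral_condExp (𝓖.le 0), integral_congr_ae h]
  refine (norm_integral_le_of_norm_le (integrable_const _)
    (Eventually.of_forall fun ω => norm_exp_OU_le hρ hQ hs hsT θ (X 0 ω))).trans ?_
  simp

lemma IsOUType.norm_joint_charFun_le (hM : IsOUType P 𝓖 Q (levyExponent b σ ρ) X)
    (hX : ∀ t, Measurable (X t)) (hadapted : Adapted 𝓖 X)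
    (hρ : IsLevyMeasure ρ) (hQ : 0 < Q) {s r T : ℝ} (hs : 0 ≤ s) (hsr : s ≤ r) (hrT : r ≤ T)
    (α β : ℝ) :
    ‖∫ ω, Complex.exp (Complex.I * α * (X s ω : ℂ)) * Complex.exp (Complex.I * β * (X r ω : ℂ)) ∂P‖
      ≤ Real.exp (-(σ ^ 2 / 2 * Real.exp (-(2 * T * Q)) * s
          * (α + Real.exp (-(r - s) * Q) * β) ^ 2))
        * Real.exp (-(σ ^ 2 / 2 * Real.exp (-(2 * T * Q)) * (r - s) * β ^ 2)) := by
  have hrs : 0 ≤ r - s := sub_nonneg.2 hsr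
  have h := hM s (r - s) hs hrs β
  rw [add_sub_cancel] at h
  have hi := integrable_exp_I_mul (P := P) (hX r) β
  have hpull := condExp_bilin_of_stronglyMeasurable_left (m := 𝓖 s) (μ := P)
    (ContinuousLinearMap.mul ℝ ℂ)
    (f := fun ω => Complex.exp (Complex.I * α * (X s ω : ℂ)))
    (g := fun ω => Complex.exp (Complex.I * β * (X r ω : ℂ)))
    (by
      have := hadapted s
      exact (by fun_prop : Measurable[𝓖 s] fun ω =>
        Complex.exp (Complex.I * α * (X s ω : ℂ))).stronglyMeasurable)
    (by
      simp only [ContinuousLinearMap.mul_apply']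
      refine hi.bdd_mul (c := 1) (integrable_exp_I_mul (hX s) α).aestronglyMeasurable
        (Eventually.of_forall fun ω => ?_)
      rw [show Complex.I * α * (X s ω : ℂ) = ((α * X s ω : ℝ) : ℂ) * Complex.I by
        push_cast; ring]
      exact (Complex.norm_exp_ofReal_mul_I _).le) hi
  simp only [ContinuousLinearMap.mul_apply'] at hpull
  have key : ∫ ω, Complex.exp (Complex.I * α * (X s ω : ℂ))
        * Complex.exp (Complex.I * β * (X r ω : ℂ)) ∂P
      = (∫ ω, Complex.exp (Complex.I * ((α + Real.exp (-(r - s) * Q) * β : ℝ) : ℂ)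
          * (X s ω : ℂ)) ∂P)
        * Complex.exp (Complex.I * ((0 : ℝ) : ℂ) * Real.exp (-(r - s) * Q) * β
          - ∫ u in Set.Icc 0 (r - s), levyExponent b σ ρ (Real.exp (-u * Q) * β)) := by
    rw [← integral_condExp (𝓖.le s), integral_congr_ae hpull, ← integral_mul_const]
    refine integral_congr_ae ?_
    filter_upwards [h] with ω hω
    rw [hω, ← Complex.exp_add, ← Complex.exp_add]
    congr 1
    push_cast
    ring
  rw [key, norm_mul]
  exact mul_le_mul (hM.norm_charFun_le hρ hQ hs (hsr.trans hrT) _)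
    (norm_exp_OU_le hρ hQ hrs (by linarith) β 0) (norm_nonneg _) (Real.exp_pos _).le

lemma IsOUType.norm_pairCharFun_le (hM : IsOUType P 𝓖 Q (levyExponent b σ ρ) X)
    (hX : ∀ t, Measurable (X t)) (hadapted : Adapted 𝓖 X)
    (hρ : IsLevyMeasure ρ) (hQ : 0 < Q) {s r T : ℝ} (hs : 0 ≤ s) (hsr : s ≤ r) (hrT : r ≤ T)
    (p : ℝ × ℝ) :
    ‖pairCharFun P (X s) (X r) p‖
      ≤ Real.exp (-(2 * Real.pi ^ 2 * σ ^ 2 * Real.exp (-(2 * T * Q)) * s)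
          * (p.1 + Real.exp (-(r - s) * Q) * p.2) ^ 2)
        * Real.exp (-(2 * Real.pi ^ 2 * σ ^ 2 * Real.exp (-(2 * T * Q)) * (r - s))
          * p.2 ^ 2) := by
  have h := hM.norm_joint_charFun_le hX hadapted hρ hQ hs hsr hrT
    (2 * Real.pi * p.1) (2 * Real.pi * p.2)
  have e : pairCharFun P (X s) (X r) p
      = ∫ ω, Complex.exp (Complex.I * ((2 * Real.pi * p.1 : ℝ) : ℂ) * (X s ω : ℂ))
        * Complex.exp (Complex.I * ((2 * Real.pi * p.2 : ℝ) : ℂ) * (X r ω : ℂ)) ∂P := by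
    unfold pairCharFun
    refine integral_congr_ae (Eventually.of_forall fun ω => ?_)
    beta_reduce
    rw [← Complex.exp_add]
    congr 1
    push_cast
    ring
  rw [e]
  refine h.trans_eq ?_
  congr 2 <;> ring

lemma IsOUType.integrable_pairCharFun (hM : IsOUType P 𝓖 Q (levyExponent b σ ρ) X)
    (hX : ∀ t, Measurable (X t)) (hadapted : Adapted 𝓖 X) (hσ : 0 < σ)
    (hρ : IsLevyMeasure ρ) (hQ : 0 < Q) {s r : ℝ} (hs : 0 < s) (hsr : s < r) :
    Integrable (pairCharFun P (X s) (X r)) := by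
  have hrs : 0 < r - s := sub_pos.2 hsr
  refine (integrable_gaussian_shear (a := 2 * Real.pi ^ 2 * σ ^ 2 * Real.exp (-(2 * r * Q)) * s)
    (d := 2 * Real.pi ^ 2 * σ ^ 2 * Real.exp (-(2 * r * Q)) * (r - s)) (by positivity)
    (by positivity) (Real.exp (-(r - s) * Q))).mono'
    (stronglyMeasurable_pairCharFun (hX s) (hX r)).aestronglyMeasurable
    (Eventually.of_forall fun p =>
      hM.norm_pairCharFun_le hX hadapted hρ hQ hs.le hsr.le le_rfl p)

/-- The constant in the bound on the total mass of the joint characteristic function. -/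
noncomputable def massConst (σ Q T : ℝ) : ℝ :=
  Real.pi / (2 * Real.pi ^ 2 * σ ^ 2 * Real.exp (-(2 * T * Q)))

lemma massConst_nonneg (σ Q T : ℝ) : 0 ≤ massConst σ Q T := by
  unfold massConst
  positivity

lemma IsOUType.integral_norm_pairCharFun_le (hM : IsOUType P 𝓖 Q (levyExponent b σ ρ) X)
    (hX : ∀ t, Measurable (X t)) (hadapted : Adapted 𝓖 X) (hσ : 0 < σ)
    (hρ : IsLevyMeasure ρ) (hQ : 0 < Q) {s r T : ℝ} (hs : 0 < s) (hsr : s < r) (hrT : r ≤ T) :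
    ∫ p, ‖pairCharFun P (X s) (X r) p‖ ≤ massConst σ Q T * (1 / √s * (1 / √(r - s))) := by
  have hrs : 0 < r - s := sub_pos.2 hsr
  refine (integral_mono (hM.integrable_pairCharFun hX hadapted hσ hρ hQ hs hsr).norm
    (integrable_gaussian_shear (a := 2 * Real.pi ^ 2 * σ ^ 2 * Real.exp (-(2 * T * Q)) * s)
      (d := 2 * Real.pi ^ 2 * σ ^ 2 * Real.exp (-(2 * T * Q)) * (r - s)) (by positivity)
      (by positivity) (Real.exp (-(r - s) * Q)))
    fun p => hM.norm_pairCharFun_le hX hadapted hρ hQ hs.le hsr.le hrT p).trans_eq ?_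
  have hm : ∀ z, Real.pi / (2 * Real.pi ^ 2 * σ ^ 2 * Real.exp (-(2 * T * Q)) * z)
      = massConst σ Q T / z := fun z => by rw [massConst, div_div]
  rw [integral_gaussian_shear, hm, hm, Real.sqrt_div (massConst_nonneg _ _ _), Real.sqrt_div (massConst_nonneg _ _ _)]
  have := Real.mul_self_sqrt (massConst_nonneg σ Q T)
  field_simp
  linarith

/-- The kernel dominating two-point correlations of the process. -/
noncomputable def corrBound (s r : ℝ) : ℝ :=
  1 / √s * (1 / √|r - s|) + 1 / √r * (1 / √|r - s|)

lemma corrBound_comm (s r : ℝ) : corrBound s r = corrBound r s := by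
  unfold corrBound
  rw [abs_sub_comm, add_comm]

open FourierTransform in
lemma IsOUType.norm_corr_le (hM : IsOUType P 𝓖 Q (levyExponent b σ ρ) X)
    (hX : ∀ t, Measurable (X t)) (hadapted : Adapted 𝓖 X) (hσ : 0 < σ)
    (hρ : IsLevyMeasure ρ) (hQ : 0 < Q) {s r T : ℝ} (hs : 0 < s) (hr : 0 < r) (hsr : s ≠ r)
    (hsT : s ≤ T) (hrT : r ≤ T) {f : ℝ → ℂ} (hf : IsSchwartzLimit f) {A : ℝ}
    (hA : ∀ w, ‖𝓕 f w‖ ≤ A) :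
    ‖∫ ω, f (X s ω) * f (X r ω) ∂P‖ ≤ A ^ 2 * massConst σ Q T * corrBound s r := by
  have hA0 : 0 ≤ A := (norm_nonneg _).trans (hA 0)
  wlog h : s < r generalizing s r
  · simp_rw [mul_comm (f (X s _)), corrBound_comm s]
    exact this hr hs hsr.symm hrT hsT (lt_of_le_of_ne (not_lt.1 h) hsr.symm)
  have hχ := hM.integrable_pairCharFun hX hadapted hσ hρ hQ hs h
  rw [hf.integral_mul (hX s) (hX r) hχ]
  have h1 : ‖∫ p : ℝ × ℝ, 𝓕 f p.1 * 𝓕 f p.2 * pairCharFun P (X s) (X r) p‖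
      ≤ ∫ p : ℝ × ℝ, A ^ 2 * ‖pairCharFun P (X s) (X r) p‖ := by
    refine norm_integral_le_of_norm_le (hχ.norm.const_mul _) (Eventually.of_forall fun p => ?_)
    rw [norm_mul, norm_mul, sq]
    gcongr
    · exact hA _
    · exact hA _
  refine h1.trans ?_
  rw [integral_const_mul, mul_assoc]
  gcongr
  refine (hM.integral_norm_pairCharFun_le hX hadapted hσ hρ hQ hs h hrT).trans ?_
  have := massConst_nonneg σ Q T
  gcongr
  unfold corrBound
  rw [abs_of_pos (sub_pos.2 h)]
  exact le_add_of_nonneg_right (by positivity)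

/-- The difference of two window kernels about `y`. -/
noncomputable def windowDiff (y ε δ z : ℝ) : ℝ := windowKernel y ε z - windowKernel y δ z

lemma isSchwartzLimit_windowDiff (y : ℝ) {ε δ : ℝ} (hε : 0 < ε) (hδ : 0 < δ) :
    IsSchwartzLimit (fun z => (windowDiff y ε δ z : ℂ)) := by
  simpa [windowDiff] using
    (isSchwartzLimit_windowKernel y hε).sub (isSchwartzLimit_windowKernel y hδ)

open FourierTransform in
lemma fourier_windowDiff (y ε δ w : ℝ) :
    𝓕 (fun z => (windowDiff y ε δ z : ℂ)) w
      = 𝓕 (fun z => (windowKernel y ε z : ℂ)) w - 𝓕 (fun z => (windowKernel y δ z : ℂ)) w := by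
  have hi : ∀ e : ℝ, Integrable (fun v => Complex.exp ((-2 * Real.pi * v * w : ℝ) * Complex.I)
      • (windowKernel y e v : ℂ)) := fun e => by
    refine (integrable_windowKernel y e).ofReal.bdd_mul (c := 1) ?_
      (Eventually.of_forall fun v => (Complex.norm_exp_ofReal_mul_I _).le)
    exact (by fun_prop : Continuous fun v : ℝ =>
      Complex.exp ((-2 * Real.pi * v * w : ℝ) * Complex.I)).aestronglyMeasurable
  simp only [Real.fourier_real_eq_integral_exp_smul]
  rw [← integral_sub (hi ε) (hi δ)]
  simp [windowDiff, mul_sub]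

open FourierTransform in
lemma norm_fourier_windowDiff_le (y : ℝ) {ε δ : ℝ} (hε : 0 < ε) (hδ : 0 < δ) (w : ℝ) :
    ‖𝓕 (fun z => (windowDiff y ε δ z : ℂ)) w‖ ≤ 2 := by
  rw [fourier_windowDiff]
  exact (norm_sub_le _ _).trans (by
    linarith [norm_fourier_windowKernel_le y hε w, norm_fourier_windowKernel_le y hδ w])

open FourierTransform in
lemma norm_fourier_windowDiff_le_mul (y : ℝ) {ε δ : ℝ} (hε : 0 < ε) (hδ : 0 < δ) (w : ℝ) :
    ‖𝓕 (fun z => (windowDiff y ε δ z : ℂ)) w‖ ≤ 2 * Real.pi * |w| * (ε + δ) := by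
  rw [fourier_windowDiff, ← sub_sub_sub_cancel_right _ _
    (Complex.exp ((-2 * Real.pi * y * w : ℝ) * Complex.I))]
  exact (norm_sub_le _ _).trans (by
    linarith [norm_fourier_windowKernel_sub_exp_le y hε w,
      norm_fourier_windowKernel_sub_exp_le y hδ w])

lemma eventually_pos_prod :
    ∀ᶠ e : ℝ × ℝ in 𝓝[>] (0 : ℝ) ×ˢ 𝓝[>] (0 : ℝ), 0 < e.1 ∧ 0 < e.2 :=
  (eventually_mem_nhdsWithin (a := (0 : ℝ)) (s := Set.Ioi 0)).prod_mk
    (eventually_mem_nhdsWithin (a := (0 : ℝ)) (s := Set.Ioi 0))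

open FourierTransform in
lemma IsOUType.tendsto_corr_windowDiff (hM : IsOUType P 𝓖 Q (levyExponent b σ ρ) X)
    (hX : ∀ t, Measurable (X t)) (hadapted : Adapted 𝓖 X) (hσ : 0 < σ)
    (hρ : IsLevyMeasure ρ) (hQ : 0 < Q) {s r : ℝ} (hs : 0 < s) (hr : 0 < r) (hsr : s ≠ r)
    (y : ℝ) :
    Tendsto (fun e : ℝ × ℝ => ∫ ω, (windowDiff y e.1 e.2 (X s ω) : ℂ)
        * (windowDiff y e.1 e.2 (X r ω) : ℂ) ∂P)
      (𝓝[>] (0 : ℝ) ×ˢ 𝓝[>] (0 : ℝ)) (𝓝 0) := by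
  wlog h : s < r generalizing s r
  · simp_rw [mul_comm (windowDiff y _ _ (X s _) : ℂ)]
    exact this hr hs hsr.symm (lt_of_le_of_ne (not_lt.1 h) hsr.symm)
  have hχ := hM.integrable_pairCharFun hX hadapted hσ hρ hQ hs h
  have hlim : Tendsto (fun e : ℝ × ℝ => ∫ p : ℝ × ℝ,
      𝓕 (fun z => (windowDiff y e.1 e.2 z : ℂ)) p.1 * 𝓕 (fun z => (windowDiff y e.1 e.2 z : ℂ)) p.2
        * pairCharFun P (X s) (X r) p) (𝓝[>] (0 : ℝ) ×ˢ 𝓝[>] (0 : ℝ))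
      (𝓝 (∫ _p : ℝ × ℝ, (0 : ℂ))) := by
    refine tendsto_integral_filter_of_dominated_convergence
      (fun p => 2 * 2 * ‖pairCharFun P (X s) (X r) p‖) ?_ ?_ (hχ.norm.const_mul _) ?_
    · filter_upwards [eventually_pos_prod] with e he
      have hcont : Continuous (𝓕 (fun z => (windowDiff y e.1 e.2 z : ℂ))) :=
        VectorFourier.fourierIntegral_continuous Real.continuous_fourierChar
          (innerSL ℝ).continuous₂
          ((integrable_windowKernel y e.1).sub (integrable_windowKernel y e.2)).ofReal
      exact (by fun_prop : Continuous fun p : ℝ × ℝ =>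
        𝓕 (fun z => (windowDiff y e.1 e.2 z : ℂ)) p.1
          * 𝓕 (fun z => (windowDiff y e.1 e.2 z : ℂ)) p.2).aestronglyMeasurable.mul
        hχ.aestronglyMeasurable
    · filter_upwards [eventually_pos_prod] with e he
      refine Eventually.of_forall fun p => ?_
      rw [norm_mul, norm_mul]
      gcongr
      · exact norm_fourier_windowDiff_le y he.1 he.2 _
      · exact norm_fourier_windowDiff_le y he.1 he.2 _
    · refine Eventually.of_forall fun p => ?_
      have h0 : ∀ w : ℝ, Tendsto (fun e : ℝ × ℝ => 𝓕 (fun z => (windowDiff y e.1 e.2 z : ℂ)) w)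
          (𝓝[>] (0 : ℝ) ×ˢ 𝓝[>] (0 : ℝ)) (𝓝 0) := fun w => by
        have hb : Tendsto (fun e : ℝ × ℝ => 2 * Real.pi * |w| * (e.1 + e.2))
            (𝓝[>] (0 : ℝ) ×ˢ 𝓝[>] (0 : ℝ)) (𝓝 0) := by
          have h1 : Tendsto (fun e : ℝ × ℝ => e.1) (𝓝[>] (0 : ℝ) ×ˢ 𝓝[>] (0 : ℝ)) (𝓝 0) :=
            tendsto_fst.mono_right nhdsWithin_le_nhds
          have h2 : Tendsto (fun e : ℝ × ℝ => e.2) (𝓝[>] (0 : ℝ) ×ˢ 𝓝[>] (0 : ℝ)) (𝓝 0) :=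
            tendsto_snd.mono_right nhdsWithin_le_nhds
          simpa using (h1.add h2).const_mul (2 * Real.pi * |w|)
        refine squeeze_zero_norm' ?_ hb
        filter_upwards [eventually_pos_prod] with e he
        exact norm_fourier_windowDiff_le_mul y he.1 he.2 w
      simpa using ((h0 p.1).mul (h0 p.2)).mul_const (pairCharFun P (X s) (X r) p)
  rw [integral_zero] at hlim
  refine hlim.congr' ?_
  filter_upwards [eventually_pos_prod] with e he
  exact ((isSchwartzLimit_windowDiff y he.1 he.2).integral_mul (hX s) (hX r) hχ).symm

end OU

lemma lintegral_one_div_sqrt {a b : ℝ} (ha : 0 ≤ a) (hab : a ≤ b) :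
    ∫⁻ s in Set.Icc a b, ENNReal.ofReal (1 / √s) = ENNReal.ofReal (2 * (√b - √a)) := by
  have he : ∀ s ∈ Set.Ioc a b, 1 / √s = s ^ (-(1 / 2) : ℝ) := fun s hs => by
    rw [Real.rpow_neg (ha.trans hs.1.le), ← Real.sqrt_eq_rpow, one_div]
  have hi : IntervalIntegrable (fun s : ℝ => s ^ (-(1 / 2) : ℝ)) volume a b :=
    intervalIntegral.intervalIntegrable_rpow' (by norm_num)
  rw [intervalIntegrable_iff_integrableOn_Ioc_of_le hab] at hi
  rw [← restrict_Ioc_eq_restrict_Icc, setLIntegral_congr_fun measurableSet_Ioc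
    (fun s hs => congrArg ENNReal.ofReal (he s hs)), ← ofReal_integral_eq_lintegral_ofReal hi
    ((ae_restrict_iff' measurableSet_Ioc).2 (Eventually.of_forall fun s hs =>
      Real.rpow_nonneg (ha.trans hs.1.le) _)), ← intervalIntegral.integral_of_le hab,
    integral_rpow (Or.inl (by norm_num)), Real.sqrt_eq_rpow, Real.sqrt_eq_rpow]
  congr 1
  norm_num
  ring

lemma lintegral_one_div_sqrt_abs_sub_le {a b s : ℝ} (hs : s ∈ Set.Icc a b) :
    ∫⁻ r in Set.Icc a b, ENNReal.ofReal (1 / √|r - s|) ≤ ENNReal.ofReal (4 * √(b - a)) := by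
  have hm : Measurable fun u : ℝ => ENNReal.ofReal (1 / √u) := by fun_prop
  have h1 : ∫⁻ r in Set.Icc a s, ENNReal.ofReal (1 / √|r - s|)
      = ENNReal.ofReal (2 * √(s - a)) := by
    rw [← setLIntegral_congr_fun (f := fun r => ENNReal.ofReal (1 / √(s - r))) measurableSet_Icc
      (fun r hr => by
        change ENNReal.ofReal (1 / √(s - r)) = ENNReal.ofReal (1 / √|r - s|)
        rw [abs_sub_comm, abs_of_nonneg (sub_nonneg.2 hr.2)])]
    have := (Measure.measurePreserving_sub_left volume s).setLIntegral_comp_preimage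
      (measurableSet_Icc (a := 0) (b := s - a)) hm
    rw [lintegral_one_div_sqrt le_rfl (sub_nonneg.2 hs.1)] at this
    simpa using this
  have h2 : ∫⁻ r in Set.Icc s b, ENNReal.ofReal (1 / √|r - s|)
      = ENNReal.ofReal (2 * √(b - s)) := by
    rw [← setLIntegral_congr_fun (f := fun r => ENNReal.ofReal (1 / √(r - s))) measurableSet_Icc
      (fun r hr => by
        change ENNReal.ofReal (1 / √(r - s)) = ENNReal.ofReal (1 / √|r - s|)
        rw [abs_of_nonneg (sub_nonneg.2 hr.1)])]
    have := (measurePreserving_sub_right volume s).setLIntegral_comp_preimage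
      (measurableSet_Icc (a := 0) (b := b - s)) hm
    rw [lintegral_one_div_sqrt le_rfl (sub_nonneg.2 hs.2)] at this
    simpa using this
  calc ∫⁻ r in Set.Icc a b, ENNReal.ofReal (1 / √|r - s|)
      ≤ ∫⁻ r in Set.Icc a s ∪ Set.Icc s b, ENNReal.ofReal (1 / √|r - s|) :=
        lintegral_mono_set Set.Icc_subset_Icc_union_Icc
    _ ≤ ENNReal.ofReal (2 * √(s - a)) + ENNReal.ofReal (2 * √(b - s)) := by
        rw [← h1, ← h2]; exact lintegral_union_le _ _ _
    _ ≤ _ := by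
        rw [← ENNReal.ofReal_add (by positivity) (by positivity)]
        refine ENNReal.ofReal_le_ofReal ?_
        have := Real.sqrt_le_sqrt (sub_le_sub_right hs.2 a)
        have := Real.sqrt_le_sqrt (sub_le_sub_left hs.1 b)
        linarith

lemma measurable_corrBound : Measurable fun z : ℝ × ℝ => corrBound z.1 z.2 := by
  unfold corrBound
  fun_prop

lemma lintegral_corrBound_le {a b : ℝ} (ha : 0 ≤ a) (hab : a ≤ b) :
    ∫⁻ z, ENNReal.ofReal (corrBound z.1 z.2)
        ∂((volume.restrict (Set.Icc a b)).prod (volume.restrict (Set.Icc a b)))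
      ≤ ENNReal.ofReal (16 * (√(b - a) * (√b - √a))) := by
  have hsq : √a ≤ √b := Real.sqrt_le_sqrt hab
  have hI : ∫⁻ s in Set.Icc a b, ENNReal.ofReal (1 / √s)
      * ∫⁻ r in Set.Icc a b, ENNReal.ofReal (1 / √|r - s|)
      ≤ ENNReal.ofReal (8 * (√(b - a) * (√b - √a))) := by
    calc _ ≤ ∫⁻ s in Set.Icc a b, ENNReal.ofReal (1 / √s) * ENNReal.ofReal (4 * √(b - a)) :=
          setLIntegral_mono (by fun_prop) fun s hs => by
            gcongr
            exact lintegral_one_div_sqrt_abs_sub_le hs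
      _ = _ := by
          rw [lintegral_mul_const _ (by fun_prop), lintegral_one_div_sqrt ha hab,
            ← ENNReal.ofReal_mul (by linarith)]
          congr 1
          ring
  have e : ∀ s r : ℝ, ENNReal.ofReal (corrBound s r)
      = ENNReal.ofReal (1 / √s) * ENNReal.ofReal (1 / √|r - s|)
        + ENNReal.ofReal (1 / √r) * ENNReal.ofReal (1 / √|s - r|) := fun s r => by
    rw [← ENNReal.ofReal_mul (by positivity), ← ENNReal.ofReal_mul (by positivity),
      ← ENNReal.ofReal_add (by positivity) (by positivity), abs_sub_comm s r, corrBound]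
  simp only [e]
  rw [lintegral_add_left (by fun_prop), lintegral_prod _ (by fun_prop),
    lintegral_prod_symm _ (by fun_prop)]
  simp only
  have hm : ∀ s : ℝ, Measurable fun r : ℝ => ENNReal.ofReal (1 / √|r - s|) := fun s => by
    fun_prop
  simp only [lintegral_const_mul _ (hm _)]
  refine (add_le_add hI hI).trans_eq ?_
  have : 0 ≤ √(b - a) * (√b - √a) := mul_nonneg (by positivity) (by linarith)
  rw [← ENNReal.ofReal_add (by positivity) (by positivity)]
  congr 1
  ring

lemma ae_prod_restrict_Icc {a b : ℝ} (ha : 0 ≤ a) :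
    ∀ᵐ z ∂((volume.restrict (Set.Icc a b)).prod (volume.restrict (Set.Icc a b))),
      0 < z.1 ∧ 0 < z.2 ∧ z.1 ≠ z.2 ∧ z.1 ≤ b ∧ z.2 ≤ b := by
  have hmeas : MeasurableSet
      {z : ℝ × ℝ | 0 < z.1 ∧ 0 < z.2 ∧ z.1 ≠ z.2 ∧ z.1 ≤ b ∧ z.2 ≤ b} := by
    refine (measurableSet_lt measurable_const measurable_fst).inter
      ((measurableSet_lt measurable_const measurable_snd).inter
      ((measurableSet_eq_fun measurable_fst measurable_snd).compl.inter
      ((measurableSet_le measurable_fst measurable_const).inter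
      (measurableSet_le measurable_snd measurable_const))))
  have hpos : ∀ᵐ s ∂(volume.restrict (Set.Icc a b)), 0 < s ∧ s ≤ b := by
    filter_upwards [ae_restrict_mem measurableSet_Icc,
      ae_restrict_of_ae (Measure.ae_ne volume (0 : ℝ))] with s hs hs0
    exact ⟨lt_of_le_of_ne (ha.trans hs.1) (Ne.symm hs0), hs.2⟩
  refine (Measure.ae_prod_iff_ae_ae hmeas).2 ?_
  filter_upwards [hpos] with s hs
  filter_upwards [hpos, ae_restrict_of_ae (Measure.ae_ne volume s)] with r hr hrs
  exact ⟨hs.1, hr.1, Ne.symm hrs, hs.2, hr.2⟩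

lemma eLpNorm_two_sq {Ω : Type*} {m : MeasurableSpace Ω} {P : Measure Ω} (f : Ω → ℝ) :
    eLpNorm f 2 P ^ 2 = ∫⁻ ω, ‖f ω‖ₑ ^ 2 ∂P := by
  have := eLpNorm_nnreal_pow_eq_lintegral (f := f) (μ := P) (p := 2) two_ne_zero
  simpa using this

section SecondMoment

variable {Ω : Type*} {m : MeasurableSpace Ω} {P : Measure Ω} [IsProbabilityMeasure P]
  {X : ℝ → Ω → ℝ}

lemma stronglyMeasurable_corr (hX : Measurable (Function.uncurry X)) {f : ℝ → ℝ}
    (hf : Measurable f) :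
    StronglyMeasurable fun z : ℝ × ℝ => ∫ ω, f (X z.1 ω) * f (X z.2 ω) ∂P := by
  have h1 : Measurable fun q : (ℝ × ℝ) × Ω => X q.1.1 q.2 :=
    hX.comp (measurable_fst.fst.prodMk measurable_snd)
  have h2 : Measurable fun q : (ℝ × ℝ) × Ω => X q.1.2 q.2 :=
    hX.comp (measurable_fst.snd.prodMk measurable_snd)
  have : Measurable (Function.uncurry fun (z : ℝ × ℝ) (ω : Ω) => f (X z.1 ω) * f (X z.2 ω)) :=
    (hf.comp h1).mul (hf.comp h2)
  exact this.stronglyMeasurable.integral_prod_right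

lemma integral_sq_integral_eq (hX : Measurable (Function.uncurry X)) {f : ℝ → ℝ}
    (hf : Measurable f) {C : ℝ} (hC : ∀ z, |f z| ≤ C) (μ : Measure ℝ) [IsFiniteMeasure μ] :
    ∫ ω, (∫ s, f (X s ω) ∂μ) ^ 2 ∂P
      = ∫ z : ℝ × ℝ, (∫ ω, f (X z.1 ω) * f (X z.2 ω) ∂P) ∂(μ.prod μ) := by
  have hC0 : 0 ≤ C := (abs_nonneg _).trans (hC 0)
  have h1 : Measurable fun q : Ω × (ℝ × ℝ) => X q.2.1 q.1 :=
    hX.comp (measurable_snd.fst.prodMk measurable_fst)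
  have h2 : Measurable fun q : Ω × (ℝ × ℝ) => X q.2.2 q.1 :=
    hX.comp (measurable_snd.snd.prodMk measurable_fst)
  have hprodInt : Integrable (Function.uncurry fun (ω : Ω) (z : ℝ × ℝ) => f (X z.1 ω) * f (X z.2 ω))
      (P.prod (μ.prod μ)) := by
    refine Integrable.of_bound (C := C * C)
      ((hf.comp h1).mul (hf.comp h2)).aestronglyMeasurable (Eventually.of_forall fun q => ?_)
    simp only [Function.uncurry, norm_mul, Real.norm_eq_abs]
    exact mul_le_mul (hC _) (hC _) (abs_nonneg _) hC0
  rw [← integral_integral_swap hprodInt]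
  refine integral_congr_ae (Eventually.of_forall fun ω => ?_)
  beta_reduce
  rw [sq, ← integral_prod_mul]

lemma lintegral_sq_integral_le (hX : Measurable (Function.uncurry X)) {f : ℝ → ℝ}
    (hf : Measurable f) {C : ℝ} (hC : ∀ z, |f z| ≤ C) (μ : Measure ℝ) [IsFiniteMeasure μ] :
    ∫⁻ ω, ‖∫ s, f (X s ω) ∂μ‖ₑ ^ 2 ∂P
      ≤ ∫⁻ z : ℝ × ℝ, ‖∫ ω, f (X z.1 ω) * f (X z.2 ω) ∂P‖ₑ ∂(μ.prod μ) := by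
  have hXs : Measurable fun q : Ω × ℝ => f (X q.2 q.1) :=
    hf.comp (hX.comp (measurable_snd.prodMk measurable_fst))
  have hm : StronglyMeasurable fun ω => ∫ s, f (X s ω) ∂μ :=
    StronglyMeasurable.integral_prod_right (f := fun ω s => f (X s ω)) hXs.stronglyMeasurable
  have hb : ∀ ω, ‖(∫ s, f (X s ω) ∂μ) ^ 2‖ ≤ (C * μ.real Set.univ) ^ 2 := fun ω => by
    rw [norm_pow]
    gcongr
    exact norm_integral_le_of_norm_le_const (Eventually.of_forall fun s => hC _)
  have hi : Integrable (fun ω => (∫ s, f (X s ω) ∂μ) ^ 2) P :=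
    Integrable.of_bound (hm.pow 2).aestronglyMeasurable _ (Eventually.of_forall hb)
  calc ∫⁻ ω, ‖∫ s, f (X s ω) ∂μ‖ₑ ^ 2 ∂P
      = ∫⁻ ω, ENNReal.ofReal ((∫ s, f (X s ω) ∂μ) ^ 2) ∂P := by
        refine lintegral_congr fun ω => ?_
        rw [← enorm_pow, Real.enorm_of_nonneg (sq_nonneg _)]
    _ = ENNReal.ofReal (∫ ω, (∫ s, f (X s ω) ∂μ) ^ 2 ∂P) :=
        (ofReal_integral_eq_lintegral_ofReal hi (Eventually.of_forall fun ω => sq_nonneg _)).symm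
    _ ≤ ‖∫ ω, (∫ s, f (X s ω) ∂μ) ^ 2 ∂P‖ₑ := Real.ofReal_le_enorm _
    _ ≤ _ := by
        rw [integral_sq_integral_eq hX hf hC]
        exact enorm_integral_le_lintegral_enorm _

end SecondMoment

lemma abs_windowKernel_le (y : ℝ) {ε : ℝ} (hε : 0 < ε) (z : ℝ) :
    |windowKernel y ε z| ≤ 1 / (2 * ε) := by
  rw [abs_of_nonneg (windowKernel_nonneg y hε z)]
  exact windowKernel_le y hε z

lemma measurable_windowDiff (y ε δ : ℝ) : Measurable (windowDiff y ε δ) :=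
  (measurable_windowKernel y ε).sub (measurable_windowKernel y δ)

lemma abs_windowDiff_le (y : ℝ) {ε δ : ℝ} (hε : 0 < ε) (hδ : 0 < δ) (z : ℝ) :
    |windowDiff y ε δ z| ≤ 1 / (2 * ε) + 1 / (2 * δ) :=
  (abs_sub _ _).trans (add_le_add (abs_windowKernel_le y hε z) (abs_windowKernel_le y hδ z))

/-- The normalized occupation time of the window of radius `ε` about `y`, up to time `t`. -/
noncomputable def occupation {Ω : Type*} (X : ℝ → Ω → ℝ) (y ε t : ℝ) (ω : Ω) : ℝ :=
  ∫ s in Set.Icc 0 t, windowKernel y ε (X s ω)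

section Occupation

variable {Ω : Type*} {m : MeasurableSpace Ω} {P : Measure Ω} [IsProbabilityMeasure P]
  {𝓖 : Filtration ℝ m} {Q b σ : ℝ} {ρ : Measure ℝ} {X : ℝ → Ω → ℝ}

lemma integrable_windowKernel_comp (hX : ∀ ω, Measurable fun s => X s ω) (y : ℝ) {ε : ℝ}
    (hε : 0 < ε) (μ : Measure ℝ) [IsFiniteMeasure μ] (ω : Ω) :
    Integrable (fun s => windowKernel y ε (X s ω)) μ :=
  Integrable.of_bound ((measurable_windowKernel y ε).comp (hX ω)).aestronglyMeasurable _
    (Eventually.of_forall fun _ => abs_windowKernel_le y hε _)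

lemma measurable_occupation (hX : Measurable (Function.uncurry X)) (y ε t : ℝ) :
    Measurable (occupation X y ε t) := by
  have hXs : Measurable fun q : Ω × ℝ => windowKernel y ε (X q.2 q.1) :=
    (measurable_windowKernel y ε).comp (hX.comp (measurable_snd.prodMk measurable_fst))
  exact (StronglyMeasurable.integral_prod_right (f := fun ω s => windowKernel y ε (X s ω))
    hXs.stronglyMeasurable).measurable

lemma occupation_sub_occupation (hX : ∀ ω, Measurable fun s => X s ω) (y : ℝ) {ε : ℝ}
    (hε : 0 < ε) {s t : ℝ} (hs : 0 ≤ s) (hst : s ≤ t) (ω : Ω) :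
    occupation X y ε t ω - occupation X y ε s ω
      = ∫ u in Set.Icc s t, windowKernel y ε (X u ω) := by
  have hi : ∀ a c, IntervalIntegrable (fun u => windowKernel y ε (X u ω)) volume a c :=
    fun a c => ⟨integrable_windowKernel_comp hX y hε _ ω, integrable_windowKernel_comp hX y hε _ ω⟩
  simp only [occupation, integral_Icc_eq_integral_Ioc, ← intervalIntegral.integral_of_le hs,
    ← intervalIntegral.integral_of_le hst, ← intervalIntegral.integral_of_le (hs.trans hst)]
  exact intervalIntegral.integral_interval_sub_left (hi _ _) (hi _ _)

lemma occupation_mono (hX : ∀ ω, Measurable fun s => X s ω) (y : ℝ) {ε : ℝ}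
    (hε : 0 < ε) {s t : ℝ} (hs : 0 ≤ s) (hst : s ≤ t) (ω : Ω) :
    occupation X y ε s ω ≤ occupation X y ε t ω := by
  rw [← sub_nonneg, occupation_sub_occupation hX y hε hs hst]
  exact integral_nonneg fun _ => windowKernel_nonneg y hε _

lemma occupation_nonneg (y : ℝ) {ε : ℝ} (hε : 0 < ε) (t : ℝ) (ω : Ω) :
    0 ≤ occupation X y ε t ω :=
  integral_nonneg fun _ => windowKernel_nonneg y hε _

lemma IsOUType.lintegral_sq_occupation_sub_le (hM : IsOUType P 𝓖 Q (levyExponent b σ ρ) X)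
    (hX : Measurable (Function.uncurry X)) (hadapted : Adapted 𝓖 X) (hσ : 0 < σ)
    (hρ : IsLevyMeasure ρ) (hQ : 0 < Q) (y : ℝ) {ε : ℝ} (hε : 0 < ε) {s t T : ℝ} (hs : 0 ≤ s)
    (hst : s ≤ t) (htT : t ≤ T) :
    ∫⁻ ω, ‖occupation X y ε t ω - occupation X y ε s ω‖ₑ ^ 2 ∂P
      ≤ ENNReal.ofReal (16 * massConst σ Q T * (√(t - s) * (√t - √s))) := by
  have hX2 : ∀ ω, Measurable fun s => X s ω := fun ω =>
    hX.comp (measurable_id.prodMk measurable_const)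
  have hX1 : ∀ s, Measurable (X s) := fun s => hX.comp (measurable_const.prodMk measurable_id)
  simp only [occupation_sub_occupation hX2 y hε hs hst]
  refine (lintegral_sq_integral_le hX (measurable_windowKernel y ε)
    (abs_windowKernel_le y hε) _).trans ?_
  calc _ ≤ ∫⁻ z, ENNReal.ofReal (massConst σ Q T) * ENNReal.ofReal (corrBound z.1 z.2)
        ∂((volume.restrict (Set.Icc s t)).prod (volume.restrict (Set.Icc s t))) := by
        refine lintegral_mono_ae ?_
        filter_upwards [ae_prod_restrict_Icc (b := t) hs] with z hz
        obtain ⟨h1, h2, h3, h4, h5⟩ := hz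
        have := hM.norm_corr_le hX1 hadapted hσ hρ hQ h1 h2 h3 (h4.trans htT) (h5.trans htT)
          (isSchwartzLimit_windowKernel y hε) (norm_fourier_windowKernel_le y hε)
        rw [one_pow, one_mul] at this
        rw [← ENNReal.ofReal_mul (massConst_nonneg _ _ _), ← ofReal_norm]
        refine ENNReal.ofReal_le_ofReal (le_trans (le_of_eq ?_) this)
        rw [← Complex.norm_real, ← integral_complex_ofReal]
        push_cast
        rfl
    _ ≤ _ := by
        rw [lintegral_const_mul _ measurable_corrBound.ennreal_ofReal]
        refine (mul_le_mul_right (lintegral_corrBound_le hs hst) _).trans_eq ?_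
        rw [← ENNReal.ofReal_mul (massConst_nonneg _ _ _)]
        congr 1
        ring

lemma IsOUType.tendsto_lintegral_corr (hM : IsOUType P 𝓖 Q (levyExponent b σ ρ) X)
    (hX : Measurable (Function.uncurry X)) (hadapted : Adapted 𝓖 X) (hσ : 0 < σ)
    (hρ : IsLevyMeasure ρ) (hQ : 0 < Q) (y : ℝ) {T : ℝ} (hT : 0 < T) :
    Tendsto (fun e : ℝ × ℝ => ∫⁻ z : ℝ × ℝ,
        ‖∫ ω, windowDiff y e.1 e.2 (X z.1 ω) * windowDiff y e.1 e.2 (X z.2 ω) ∂P‖ₑ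
          ∂((volume.restrict (Set.Icc 0 T)).prod (volume.restrict (Set.Icc 0 T))))
      (𝓝[>] (0 : ℝ) ×ˢ 𝓝[>] (0 : ℝ)) (𝓝 0) := by
  have hX1 : ∀ s, Measurable (X s) := fun s => hX.comp (measurable_const.prodMk measurable_id)
  have hcast : ∀ (e z : ℝ × ℝ),
      ‖∫ ω, windowDiff y e.1 e.2 (X z.1 ω) * windowDiff y e.1 e.2 (X z.2 ω) ∂P‖
      = ‖∫ ω, (windowDiff y e.1 e.2 (X z.1 ω) : ℂ) * (windowDiff y e.1 e.2 (X z.2 ω) : ℂ) ∂P‖ := by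
    intro e z
    rw [← Complex.norm_real, ← integral_complex_ofReal]
    push_cast
    rfl
  rw [← lintegral_zero (μ := (volume.restrict (Set.Icc 0 T)).prod (volume.restrict (Set.Icc 0 T)))]
  refine tendsto_lintegral_filter_of_dominated_convergence
    (fun z => ENNReal.ofReal (2 ^ 2 * massConst σ Q T) * ENNReal.ofReal (corrBound z.1 z.2))
    ?_ ?_ ?_ ?_
  · exact Eventually.of_forall fun e =>
      (stronglyMeasurable_corr hX (measurable_windowDiff y e.1 e.2)).enorm
  · filter_upwards [eventually_pos_prod] with e he
    filter_upwards [ae_prod_restrict_Icc (b := T) le_rfl] with z hz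
    obtain ⟨h1, h2, h3, h4, h5⟩ := hz
    have := hM.norm_corr_le hX1 hadapted hσ hρ hQ h1 h2 h3 h4 h5
      (isSchwartzLimit_windowDiff y he.1 he.2) (norm_fourier_windowDiff_le y he.1 he.2)
    rw [← ENNReal.ofReal_mul (mul_nonneg (by positivity) (massConst_nonneg _ _ _)), ← ofReal_norm,
      hcast]
    exact ENNReal.ofReal_le_ofReal this
  · rw [lintegral_const_mul _ measurable_corrBound.ennreal_ofReal]
    exact ENNReal.mul_ne_top ENNReal.ofReal_ne_top
      ((lintegral_corrBound_le le_rfl hT.le).trans_lt ENNReal.ofReal_lt_top).ne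
  · filter_upwards [ae_prod_restrict_Icc (b := T) le_rfl] with z hz
    obtain ⟨h1, h2, h3, -, -⟩ := hz
    have := (hM.tendsto_corr_windowDiff hX1 hadapted hσ hρ hQ h1 h2 h3 y).norm
    simp only [← hcast, norm_zero] at this
    simpa only [ofReal_norm, ENNReal.ofReal_zero] using ENNReal.tendsto_ofReal this

lemma IsOUType.tendsto_iSup_eLpNorm (hM : IsOUType P 𝓖 Q (levyExponent b σ ρ) X)
    (hX : Measurable (Function.uncurry X)) (hadapted : Adapted 𝓖 X) (hσ : 0 < σ)
    (hρ : IsLevyMeasure ρ) (hQ : 0 < Q) (y : ℝ) {T : ℝ} (hT : 0 < T) :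
    Tendsto (fun e : ℝ × ℝ => ⨆ t ∈ Set.Icc (0 : ℝ) T,
        eLpNorm (fun ω => occupation X y e.1 t ω - occupation X y e.2 t ω) 2 P)
      (𝓝[>] (0 : ℝ) ×ˢ 𝓝[>] (0 : ℝ)) (𝓝 0) := by
  have hX2 : ∀ ω, Measurable fun s => X s ω := fun ω =>
    hX.comp (measurable_id.prodMk measurable_const)
  have h := (hM.tendsto_lintegral_corr hX hadapted hσ hρ hQ y hT).ennrpow_const (2 : ℝ)⁻¹
  rw [ENNReal.zero_rpow_of_pos (by norm_num)] at h
  refine tendsto_of_tendsto_of_tendsto_of_le_of_le' tendsto_const_nhds h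
    (Eventually.of_forall fun _ => bot_le) ?_
  filter_upwards [eventually_pos_prod] with e he
  refine iSup₂_le fun t ht => ?_
  rw [ENNReal.le_rpow_inv_iff two_pos, ENNReal.rpow_two, eLpNorm_two_sq]
  have hsub : ∀ ω, occupation X y e.1 t ω - occupation X y e.2 t ω
      = ∫ s in Set.Icc 0 t, windowDiff y e.1 e.2 (X s ω) := fun ω =>
    (integral_sub (integrable_windowKernel_comp hX2 y he.1 _ ω)
      (integrable_windowKernel_comp hX2 y he.2 _ ω)).symm
  simp only [hsub]
  refine (lintegral_sq_integral_le hX (measurable_windowDiff y e.1 e.2)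
    (abs_windowDiff_le y he.1 he.2) _).trans ?_
  have hle : volume.restrict (Set.Icc 0 t) ≤ volume.restrict (Set.Icc 0 T) :=
    Measure.restrict_mono (Set.Icc_subset_Icc_right ht.2) le_rfl
  exact lintegral_mono' (Measure.prod_mono hle hle) le_rfl

end Occupation

lemma continuousOn_Ici_of_small_increments {f : ℝ → ℝ} (hf : MonotoneOn f (Set.Ici 0))
    (h : ∀ (T : ℕ) (η : ℝ), 0 < η →
      ∃ n : ℕ, ∀ k < (n + 1) * T, |f ((k + 1 : ℕ) / (n + 1 : ℝ)) - f (k / (n + 1 : ℝ))| < η) :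
    ContinuousOn f (Set.Ici 0) := by
  refine Metric.continuousOn_iff.2 fun t ht η hη => ?_
  have ht0 : (0 : ℝ) ≤ t := ht
  obtain ⟨n, hn⟩ := h (⌈t⌉₊ + 3) (η / 3) (by positivity)
  have hn0 : (0 : ℝ) < n + 1 := by positivity
  set k := ⌊t * (n + 1)⌋₊ with hk
  have hk1 : (k : ℝ) ≤ t * (n + 1) := Nat.floor_le (by positivity)
  have hk2 : t * (n + 1) < k + 1 := Nat.lt_floor_add_one _
  set j := k - 1 with hj
  have hjk : j ≤ k := Nat.sub_le _ _
  have hkj : (k : ℝ) ≤ j + 1 := by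
    have : k ≤ j + 1 := by omega
    exact_mod_cast this
  have hjk' : (j : ℝ) ≤ k := by exact_mod_cast hjk
  have hlt : j + 2 < (n + 1) * (⌈t⌉₊ + 3) := by
    have h1 : t ≤ ⌈t⌉₊ := Nat.le_ceil t
    have : (j : ℝ) + 2 < (n + 1) * (⌈t⌉₊ + 3) := by
      have : t * (n + 1) ≤ ⌈t⌉₊ * (n + 1) := by gcongr
      have : (0 : ℝ) ≤ n := by positivity
      nlinarith
    exact_mod_cast this
  have hinc : f ((j + 3 : ℕ) / (n + 1 : ℝ)) - f (j / (n + 1 : ℝ)) < η := by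
    have a1 := (abs_lt.1 (hn j (by omega))).2
    have a2 := (abs_lt.1 (hn (j + 1) (by omega))).2
    have a3 := (abs_lt.1 (hn (j + 2) (by omega))).2
    linarith
  have hmem : ∀ u : ℝ, 0 ≤ u → |u - t| < 1 / (n + 1) →
      f (j / (n + 1 : ℝ)) ≤ f u ∧ f u ≤ f ((j + 3 : ℕ) / (n + 1 : ℝ)) := by
    intro u hu hut
    have hd : (1 / (n + 1 : ℝ)) * (n + 1) = 1 := by field_simp
    obtain ⟨h1, h2⟩ := abs_lt.1 hut
    have h1' : t * (n + 1) - 1 ≤ u * (n + 1) := by nlinarith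
    have h2' : u * (n + 1) ≤ t * (n + 1) + 1 := by nlinarith
    refine ⟨hf (Set.mem_Ici.2 (by positivity)) hu ?_, hf hu (Set.mem_Ici.2 (by positivity)) ?_⟩
    · rw [div_le_iff₀ hn0]
      rcases Nat.eq_zero_or_pos k with h0 | h0
      · have : j = 0 := by omega
        rw [this, Nat.cast_zero]
        positivity
      · have : (j : ℝ) + 1 = k := by
          have : j + 1 = k := by omega
          exact_mod_cast this
        linarith
    · rw [le_div_iff₀ hn0]
      push_cast
      linarith
  refine ⟨1 / (n + 1), by positivity, fun u hu hut => ?_⟩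
  obtain ⟨h1, h2⟩ := hmem u hu hut
  obtain ⟨h3, h4⟩ := hmem t ht0 (by rw [sub_self, abs_zero]; positivity)
  rw [Real.dist_eq, abs_lt]
  constructor <;> linarith

section Limit

variable {Ω : Type*} {m : MeasurableSpace Ω} {P : Measure Ω}

lemma ae_continuousOn_of_lintegral_sq_increment_le {L : ℝ → Ω → ℝ} (hL : ∀ t, Measurable (L t))
    (hmono : ∀ᵐ ω ∂P, MonotoneOn (fun t => L t ω) (Set.Ici 0))
    (hinc : ∀ T : ℝ, ∃ K : ℝ, 0 ≤ K ∧ ∀ s t : ℝ, 0 ≤ s → s ≤ t → t ≤ T →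
      ∫⁻ ω, ‖L t ω - L s ω‖ₑ ^ 2 ∂P ≤ ENNReal.ofReal (K * (√(t - s) * (√t - √s)))) :
    ∀ᵐ ω ∂P, ContinuousOn (fun t => L t ω) (Set.Ici 0) := by
  let S : ℕ → ℕ → Ω → ENNReal := fun T n ω => ∑ k ∈ Finset.range ((n + 1) * T),
    ‖L ((k + 1 : ℕ) / (n + 1 : ℝ)) ω - L (k / (n + 1 : ℝ)) ω‖ₑ ^ 2
  have hSm : ∀ T n, Measurable (S T n) := fun T n =>
    Finset.measurable_sum _ fun k _ => ((hL _).sub (hL _)).enorm.pow_const 2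
  have hS : ∀ T : ℕ, ∀ᵐ ω ∂P, liminf (fun n => S T n ω) atTop = 0 := by
    intro T
    obtain ⟨K, hK, hKT⟩ := hinc T
    have hle : ∀ n : ℕ, ∫⁻ ω, S T n ω ∂P
        ≤ ENNReal.ofReal (K * (√(1 / (n + 1 : ℝ)) * √T)) := by
      intro n
      have hn0 : (0 : ℝ) < n + 1 := by positivity
      calc ∫⁻ ω, S T n ω ∂P
          = ∑ k ∈ Finset.range ((n + 1) * T),
            ∫⁻ ω, ‖L ((k + 1 : ℕ) / (n + 1 : ℝ)) ω - L (k / (n + 1 : ℝ)) ω‖ₑ ^ 2 ∂P :=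
            lintegral_finsetSum _ fun k _ => ((hL _).sub (hL _)).enorm.pow_const 2
        _ ≤ ∑ k ∈ Finset.range ((n + 1) * T), ENNReal.ofReal (K * (√(1 / (n + 1 : ℝ))
            * (√((k + 1 : ℕ) / (n + 1 : ℝ)) - √(k / (n + 1 : ℝ))))) := by
            refine Finset.sum_le_sum fun k hk => ?_
            have h1 : ((k + 1 : ℕ) : ℝ) / (n + 1) ≤ T := by
              rw [div_le_iff₀ hn0]
              have : k + 1 ≤ T * (n + 1) := by
                rw [mul_comm]; exact Finset.mem_range.1 hk
              exact_mod_cast this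
            refine (hKT (k / (n + 1)) ((k + 1 : ℕ) / (n + 1)) (by positivity)
              (by gcongr; exact_mod_cast k.le_succ) h1).trans_eq ?_
            rw [← sub_div]
            push_cast
            rw [add_sub_cancel_left]
        _ = ENNReal.ofReal (K * (√(1 / (n + 1 : ℝ)) * √T)) := by
            rw [← ENNReal.ofReal_sum_of_nonneg, ← Finset.mul_sum, ← Finset.mul_sum,
              Finset.sum_range_sub (fun k : ℕ => √(k / (n + 1 : ℝ)))]
            · push_cast
              rw [mul_div_cancel_left₀ _ hn0.ne']
              simp
            · intro k _
              refine mul_nonneg hK (mul_nonneg (Real.sqrt_nonneg _) (sub_nonneg.2 ?_))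
              refine Real.sqrt_le_sqrt ?_
              gcongr
              exact k.le_succ
    have hlim : Tendsto (fun n : ℕ => ENNReal.ofReal (K * (√(1 / (n + 1 : ℝ)) * √T))) atTop
        (𝓝 0) := by
      have h1 := (Real.continuous_sqrt.tendsto 0).comp
        (tendsto_one_div_add_atTop_nhds_zero_nat (𝕜 := ℝ))
      have h2 := ENNReal.tendsto_ofReal ((h1.mul_const (√T)).const_mul K)
      simpa using h2
    have h0 : ∫⁻ ω, liminf (fun n => S T n ω) atTop ∂P = 0 := by
      refine le_antisymm ((lintegral_liminf_le (hSm T)).trans ?_) bot_le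
      rw [← hlim.liminf_eq]
      exact liminf_le_liminf (Eventually.of_forall hle)
    exact (lintegral_eq_zero_iff (Measurable.liminf (hSm T))).1 h0
  filter_upwards [hmono, ae_all_iff.2 hS] with ω hω hSω
  refine continuousOn_Ici_of_small_increments hω fun T η hη => ?_
  have hlt : liminf (fun n => S T n ω) atTop < ENNReal.ofReal η ^ 2 := by
    rw [hSω T]
    exact ENNReal.pow_pos (ENNReal.ofReal_pos.2 hη) 2
  obtain ⟨n, hn⟩ := (frequently_lt_of_liminf_lt (by isBoundedDefault) hlt).exists
  refine ⟨n, fun k hk => ?_⟩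
  have h1 := (Finset.single_le_sum
    (f := fun k : ℕ => ‖L ((k + 1 : ℕ) / (n + 1 : ℝ)) ω - L (k / (n + 1 : ℝ)) ω‖ₑ ^ 2)
    (fun _ _ => bot_le) (Finset.mem_range.2 hk)).trans_lt hn
  have h2 := lt_of_not_ge fun h => h1.not_ge (pow_le_pow_left' h 2)
  rwa [← ofReal_norm, ENNReal.ofReal_lt_ofReal_iff hη] at h2

lemma eLpNorm_le_of_ae_tendsto {f : ℕ → Ω → ℝ} {g : Ω → ℝ} (hf : ∀ n, Measurable (f n))
    (hg : ∀ᵐ ω ∂P, Tendsto (fun n => f n ω) atTop (𝓝 (g ω))) {p C : ENNReal}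
    (hC : ∀ᶠ n in atTop, eLpNorm (f n) p P ≤ C) : eLpNorm g p P ≤ C :=
  (Lp.eLpNorm_lim_le_liminf_eLpNorm (fun n => (hf n).aestronglyMeasurable) g hg).trans
    (liminf_le_of_frequently_le' hC.frequently)

lemma exists_seq_ae_tendsto_of_cauchy {A : ℝ → ℝ → Ω → ℝ} (hA : ∀ ε t, Measurable (A ε t))
    (hcauchy : ∀ T : ℝ, 0 < T → Tendsto (fun e : ℝ × ℝ => ⨆ t ∈ Set.Icc (0 : ℝ) T,
        eLpNorm (fun ω => A e.1 t ω - A e.2 t ω) 2 P) (𝓝[>] (0 : ℝ) ×ˢ 𝓝[>] (0 : ℝ)) (𝓝 0)) :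
    ∃ e : ℕ → ℝ, Tendsto e atTop (𝓝[>] 0) ∧ (∀ n, 0 < e n) ∧
      ∀ t, 0 ≤ t → ∀ᵐ ω ∂P, ∃ l, Tendsto (fun n => A (e n) t ω) atTop (𝓝 l) := by
  let u : ℕ → ℝ := fun k => 1 / ((k : ℝ) + 1)
  have hu0 : ∀ k, 0 < u k := fun k => Nat.one_div_pos_of_nat
  have hu : Tendsto u atTop (𝓝[>] 0) := tendsto_nhdsWithin_iff.2
    ⟨tendsto_one_div_add_atTop_nhds_zero_nat, Eventually.of_forall hu0⟩
  have hev : ∀ n : ℕ, ∀ᶠ K in atTop, ∀ k l : ℕ, K ≤ k → K ≤ l →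
      (⨆ t ∈ Set.Icc (0 : ℝ) (n + 1), eLpNorm (fun ω => A (u k) t ω - A (u l) t ω) 2 P)
        < (2⁻¹ : ENNReal) ^ n := by
    intro n
    have h1 := ((hcauchy (n + 1) (by positivity)).comp (hu.prodMap hu)).eventually_lt_const
      (ENNReal.pow_pos (ENNReal.inv_pos.2 ENNReal.ofNat_ne_top) n : 0 < (2⁻¹ : ENNReal) ^ n)
    rw [prod_atTop_atTop_eq, eventually_atTop_prod_self'] at h1
    obtain ⟨a, ha⟩ := h1
    filter_upwards [eventually_ge_atTop a] with K hK k l hk hl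
    exact ha k (hK.trans hk) l (hK.trans hl)
  obtain ⟨φ, hφ, hφ'⟩ := extraction_forall_of_eventually hev
  refine ⟨fun n => u (φ n), hu.comp hφ.tendsto_atTop, fun n => hu0 _, fun t ht => ?_⟩
  set N₀ := ⌈t⌉₊
  have hae := Lp.ae_tendsto_of_cauchy_eLpNorm (μ := P) (p := 2)
    (f := fun n => A (u (φ (n + N₀))) t) (fun n => (hA _ _).aestronglyMeasurable)
    one_le_two (B := fun n => (2⁻¹ : ENNReal) ^ n) (by simp [ENNReal.tsum_geometric]) ?_
  · filter_upwards [hae] with ω hω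
    obtain ⟨l, hl⟩ := hω
    exact ⟨l, (tendsto_add_atTop_iff_nat N₀).1 hl⟩
  · intro N n k hn hk
    have h1 := hφ' (N + N₀) (φ (n + N₀)) (φ (k + N₀)) (hφ.monotone (by omega))
      (hφ.monotone (by omega))
    have htm : t ∈ Set.Icc (0 : ℝ) ((N + N₀ : ℕ) + 1) := by
      refine ⟨ht, (Nat.le_ceil t).trans ?_⟩
      push_cast
      have : (0 : ℝ) ≤ N := by positivity
      linarith
    refine ((le_iSup₂ (f := fun t (_ : t ∈ Set.Icc (0 : ℝ) ((N + N₀ : ℕ) + 1)) =>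
      eLpNorm (fun ω => A (u (φ (n + N₀))) t ω - A (u (φ (k + N₀))) t ω) 2 P) t htm).trans_lt
      h1).trans_le ?_
    exact pow_le_pow_of_le_one bot_le (ENNReal.inv_le_one.2 one_le_two) (Nat.le_add_right _ _)

lemma exists_limit_of_cauchy_of_increment_le {A : ℝ → ℝ → Ω → ℝ} (hA : ∀ ε t, Measurable (A ε t))
    (hnonneg : ∀ ε, 0 < ε → ∀ t ω, 0 ≤ A ε t ω)
    (hmono : ∀ ε, 0 < ε → ∀ s t, 0 ≤ s → s ≤ t → ∀ ω, A ε s ω ≤ A ε t ω)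
    (hcauchy : ∀ T : ℝ, 0 < T → Tendsto (fun e : ℝ × ℝ => ⨆ t ∈ Set.Icc (0 : ℝ) T,
        eLpNorm (fun ω => A e.1 t ω - A e.2 t ω) 2 P) (𝓝[>] (0 : ℝ) ×ˢ 𝓝[>] (0 : ℝ)) (𝓝 0))
    (hinc : ∀ T : ℝ, ∃ K : ℝ, 0 ≤ K ∧ ∀ ε, 0 < ε → ∀ s t : ℝ, 0 ≤ s → s ≤ t → t ≤ T →
      ∫⁻ ω, ‖A ε t ω - A ε s ω‖ₑ ^ 2 ∂P ≤ ENNReal.ofReal (K * (√(t - s) * (√t - √s)))) :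
    ∃ L : ℝ → Ω → ℝ,
      (∀ T : ℝ, 0 < T → Tendsto (fun ε : ℝ => ⨆ t ∈ Set.Icc (0 : ℝ) T,
        eLpNorm (fun ω => A ε t ω - L t ω) 2 P) (𝓝[>] 0) (𝓝 0)) ∧
      ∀ᵐ ω ∂P, ContinuousOn (fun t => L t ω) (Set.Ici 0) := by
  obtain ⟨e, he, he0, hconv⟩ := exists_seq_ae_tendsto_of_cauchy hA hcauchy
  let ℓ : ℝ → Ω → ENNReal := fun t ω => limsup (fun n => ENNReal.ofReal (A (e n) t ω)) atTop
  have hℓm : ∀ t, Measurable (ℓ t) := fun t => Measurable.limsup fun n => (hA _ _).ennreal_ofReal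
  have hℓmono : ∀ ω s t, 0 ≤ s → s ≤ t → ℓ s ω ≤ ℓ t ω := fun ω s t hs hst =>
    limsup_le_limsup (Eventually.of_forall fun n =>
      ENNReal.ofReal_le_ofReal (hmono _ (he0 n) s t hs hst ω))
  have hℓ : ∀ t, 0 ≤ t → ∀ᵐ ω ∂P, ℓ t ω ≠ ⊤ ∧
      Tendsto (fun n => A (e n) t ω) atTop (𝓝 (ℓ t ω).toReal) := by
    intro t ht
    filter_upwards [hconv t ht] with ω hω
    obtain ⟨l, hl⟩ := hω
    have h1 : ℓ t ω = ENNReal.ofReal l := (ENNReal.tendsto_ofReal hl).limsup_eq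
    rw [h1, ENNReal.toReal_ofReal (ge_of_tendsto' hl fun n => hnonneg _ (he0 n) t ω)]
    exact ⟨ENNReal.ofReal_ne_top, hl⟩
  refine ⟨fun t ω => (ℓ t ω).toReal, fun T hT => ?_, ?_⟩
  · refine ENNReal.tendsto_nhds_zero.2 fun η hη => ?_
    have h1 := (ENNReal.tendsto_nhds_zero.1 (hcauchy T hT) η hη).curry
    filter_upwards [h1] with ε hε
    refine iSup₂_le fun t ht => ?_
    refine eLpNorm_le_of_ae_tendsto (f := fun n ω => A ε t ω - A (e n) t ω)
      (fun n => (hA _ _).sub (hA _ _)) ?_ ?_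
    · filter_upwards [hℓ t ht.1] with ω hω
      exact hω.2.const_sub _
    · filter_upwards [he.eventually hε] with n hn
      exact (le_iSup₂ (f := fun t (_ : t ∈ Set.Icc (0 : ℝ) T) =>
        eLpNorm (fun ω => A ε t ω - A (e n) t ω) 2 P) t ht).trans hn
  · refine ae_continuousOn_of_lintegral_sq_increment_le (fun t => (hℓm t).ennreal_toReal) ?_ ?_
    · filter_upwards [ae_all_iff.2 fun N : ℕ => hℓ N N.cast_nonneg] with ω hω s hs t ht hst
      exact ENNReal.toReal_mono (ne_top_of_le_ne_top (hω ⌈t⌉₊).1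
        (hℓmono ω _ _ ht (Nat.le_ceil t))) (hℓmono ω s t hs hst)
    · intro T
      obtain ⟨K, hK, hKT⟩ := hinc T
      refine ⟨K, hK, fun s t hs hst htT => ?_⟩
      rw [← eLpNorm_two_sq, ← ENNReal.rpow_two, ← ENNReal.le_rpow_inv_iff two_pos]
      refine eLpNorm_le_of_ae_tendsto (f := fun n ω => A (e n) t ω - A (e n) s ω)
        (fun n => (hA _ _).sub (hA _ _)) ?_ (Eventually.of_forall fun n => ?_)
      · filter_upwards [hℓ t (hs.trans hst), hℓ s hs] with ω h1 h2
        exact h1.2.sub h2.2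
      · rw [ENNReal.le_rpow_inv_iff two_pos, ENNReal.rpow_two, eLpNorm_two_sq]
        exact hKT _ (he0 n) s t hs hst htT

end Limit

/-- Theorem 4.1 (case `σ > 0`): for a.e. level `y`, the normalized occupation times
`(1/2ε)∫₀^t 1_{|X_s−y|<ε} ds` converge in `L²(P)`, uniformly on compact time intervals,
to a local time `L(y,·)`, which admits an a.s. continuous modification. -/
theorem local_time_uniform_L2_convergence
    {Ω : Type*} {m : MeasurableSpace Ω} (P : Measure Ω) [IsProbabilityMeasure P]
    (𝓕 : Filtration ℝ m) (Q x : ℝ) (hQ : 0 < Q)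
    (b σ : ℝ) (hσ : 0 < σ) (ρ : Measure ℝ) (hρ : IsLevyMeasure ρ)
    (ψ : ℝ → ℂ) (hψ : ∀ θ : ℝ, ψ θ = levyExponent b σ ρ θ)
    (X : ℝ → Ω → ℝ) (hX : Measurable (Function.uncurry X)) (hadapted : Adapted 𝓕 X)
    (hstart : ∀ᵐ ω ∂P, X 0 ω = x)
    (hMarkov : ∀ t s : ℝ, 0 ≤ t → 0 ≤ s → ∀ θ : ℝ,
      P[fun ω => Complex.exp (Complex.I * θ * (X (t + s) ω : ℂ)) | 𝓕 t]
        =ᵐ[P] fun ω => Complex.exp (Complex.I * (X t ω : ℂ) * Real.exp (-s * Q) * θ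
          - ∫ u in Set.Icc 0 s, ψ (Real.exp (-u * Q) * θ))) :
    ∀ᵐ y : ℝ ∂(volume : Measure ℝ), ∃ L : ℝ → Ω → ℝ,
      (∀ T : ℝ, 0 < T →
        Tendsto (fun ε : ℝ =>
            ⨆ t ∈ Set.Icc (0 : ℝ) T, eLpNorm (fun ω =>
              (1 / (2 * ε)) * (∫ s in Set.Icc (0 : ℝ) t,
                if |X s ω - y| < ε then (1 : ℝ) else 0) - L t ω) 2 P)
          (𝓝[>] 0) (𝓝 0)) ∧
      (∃ L' : ℝ → Ω → ℝ, (∀ t : ℝ, 0 ≤ t → L' t =ᵐ[P] L t) ∧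
        ∀ᵐ ω ∂P, ContinuousOn (fun t => L' t ω) (Set.Ici 0)) := by
  obtain rfl : ψ = levyExponent b σ ρ := funext hψ
  have hM : IsOUType P 𝓕 Q (levyExponent b σ ρ) X := hMarkov
  have hX2 : ∀ ω, Measurable fun s => X s ω := fun ω =>
    hX.comp (measurable_id.prodMk measurable_const)
  refine Eventually.of_forall fun y => ?_
  obtain ⟨L, hL, hcont⟩ := exists_limit_of_cauchy_of_increment_le (P := P)
    (A := occupation X y) (measurable_occupation hX y)
    (fun ε hε t ω => occupation_nonneg y hε t ω)
    (fun ε hε s t hs hst ω => occupation_mono hX2 y hε hs hst ω)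
    (fun T hT => hM.tendsto_iSup_eLpNorm hX hadapted hσ hρ hQ y hT)
    (fun T => ⟨16 * massConst σ Q T, mul_nonneg (by norm_num) (massConst_nonneg _ _ _),
      fun ε hε s t hs hst htT =>
        hM.lintegral_sq_occupation_sub_le hX hadapted hσ hρ hQ y hε hs hst htT⟩)
  refine ⟨L, fun T hT => ?_, L, fun t _ => EventuallyEq.rfl, hcont⟩
  simpa only [occupation, windowKernel, integral_const_mul] using hL T hT
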